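/- arXiv:0712.3736 — 2 statements merged into one kernel-verified Lean document; each statement's English description precedes it below -/
import Mathlib

section
/- Let P be a finite subset of the Euclidean plane ℝ² such that Int(P) has exactly 2 elements and I_c(P) = 0. Then (𝒱(P)).ncard = P.ncard. -/
open Set

abbrev Plane : Type := EuclideanSpace ℝ (Fin 2)

/-- The Voronoi cell of a generator `p` for a generating set `P`. -/
def cell (P : Set Plane) (p : Plane) : Set Plane :=
  {x : Plane | ∀ q ∈ P, dist x p ≤ dist x q}

/-- The set of nearest generators of `x` in `P`. -/
def nearest (P : Set Plane) (x : Plane) : Set Plane :=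
  {p ∈ P | ∀ q ∈ P, dist x p ≤ dist x q}

/-- The Voronoi vertex set: points with at least 3 nearest generators. -/
def vtx (P : Set Plane) : Set Plane :=
  {x : Plane | 3 ≤ (nearest P x).encard}

/-- The boundary of a point set: its points on the frontier of its convex hull. -/
def Bd (S : Set Plane) : Set Plane :=
  S ∩ frontier (convexHull ℝ S)

/-- The number of instances of cocircularity. -/
noncomputable def Ic (P : Set Plane) : ℤ :=
  ∑ᶠ x ∈ vtx P, (((nearest P x).ncard : ℤ) - 3)

/-- The segment joining `b` to `c`, drawn in the coordinates `(f, g)`, passes strictly above `p`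
for some points `b`, `c` of `s` lying on the two sides of `p`. -/
def IsBelowChord {ι : Type*} (f g : ι → ℝ) (s : Set ι) (p : ι) : Prop :=
  ∃ b ∈ s, ∃ c ∈ s, f b < f p ∧ f p < f c ∧
    0 < (f c - f p) * (g b - g p) + (f p - f b) * (g c - g p)

/-- A point which is below no chord admits a nonvertical supporting line from above. -/
lemma exists_slope_of_not_isBelowChord {ι : Type*} {f g : ι → ℝ} {s : Set ι} (hs : s.Finite)
    {p : ι} (hf : ∀ q ∈ s, f q = f p → q = p) (h : ¬ IsBelowChord f g s p) :
    ∃ t : ℝ, ∀ q ∈ s, g q - g p ≤ t * (f q - f p) := by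
  suffices hsep : ∃ t : ℝ, (∀ q ∈ s, f p < f q → (g q - g p) / (f q - f p) ≤ t) ∧
      (∀ q ∈ s, f q < f p → t ≤ (g q - g p) / (f q - f p)) by
    obtain ⟨t, hR, hL⟩ := hsep
    refine ⟨t, fun q hq => ?_⟩
    rcases lt_trichotomy (f q) (f p) with hlt | heq | hgt
    · have := hL q hq hlt
      rwa [le_div_iff_of_neg (by linarith)] at this
    · rw [hf q hq heq]; simp
    · have := hR q hq hgt
      rwa [div_le_iff₀ (by linarith)] at this
  have hle : ∀ b ∈ s, ∀ c ∈ s, f b < f p → f p < f c →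
      (g c - g p) / (f c - f p) ≤ (g b - g p) / (f b - f p) := by
    intro b hb c hc hbp hpc
    by_contra! hlt
    refine h ⟨b, hb, c, hc, hbp, hpc, ?_⟩
    rw [lt_div_iff₀ (by linarith), div_mul_eq_mul_div, div_lt_iff_of_neg (by linarith)] at hlt
    linarith
  by_cases hR : ({q ∈ s | f p < f q}).Nonempty
  · obtain ⟨c, ⟨hc, hpc⟩, hmax⟩ := Set.exists_max_image {q ∈ s | f p < f q}
      (fun q => (g q - g p) / (f q - f p)) (hs.subset (Set.sep_subset _ _)) hR
    exact ⟨_, fun q hq hpq => hmax q ⟨hq, hpq⟩, fun q hq hqp => hle q hq c hc hqp hpc⟩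
  by_cases hL : ({q ∈ s | f q < f p}).Nonempty
  · obtain ⟨b, ⟨hb, hbp⟩, hmin⟩ := Set.exists_min_image {q ∈ s | f q < f p}
      (fun q => (g q - g p) / (f q - f p)) (hs.subset (Set.sep_subset _ _)) hL
    exact ⟨_, fun q hq hpq => (hR ⟨q, hq, hpq⟩).elim, fun q hq hqp => hmin q ⟨hq, hqp⟩⟩
  · exact ⟨0, fun q hq hpq => (hR ⟨q, hq, hpq⟩).elim, fun q hq hqp => (hL ⟨q, hq, hqp⟩).elim⟩

/-- In coordinates centred at `p`, the Voronoi cell of a point below a chord has a highest point,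
and `p` is below a chord of the generators nearest to it. -/
lemma exists_highest_of_isBelowChord {ι : Type*} {f g : ι → ℝ} {s : Set ι} (hs : s.Finite)
    {p : ι} (hf : ∀ q ∈ s, f q = f p → q = p) (h : IsBelowChord f g s p) :
    ∃ z : ℝ × ℝ, (∀ q ∈ s, 2 * (z.1 * (f q - f p) + z.2 * (g q - g p)) ≤
        (f q - f p) ^ 2 + (g q - g p) ^ 2) ∧
      IsBelowChord f g {q ∈ s | 2 * (z.1 * (f q - f p) + z.2 * (g q - g p)) =
        (f q - f p) ^ 2 + (g q - g p) ^ 2} p := by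
  set D : Set (ℝ × ℝ) := {z | (∀ q ∈ s, 2 * (z.1 * (f q - f p) + z.2 * (g q - g p)) ≤
        (f q - f p) ^ 2 + (g q - g p) ^ 2) ∧ 0 ≤ z.2} with hD
  have hclosed : IsClosed D := by
    simp only [hD, Set.ofPred_and, Set.ofPred_forall]
    refine IsClosed.inter (isClosed_biInter fun q _ => isClosed_le ?_ ?_) (isClosed_le ?_ ?_) <;>
      fun_prop
  have hcompact : IsCompact D := by
    obtain ⟨b, hb, c, hc, hbp, hpc, hpos⟩ := h
    set b₁ := f b - f p with hb₁
    set b₂ := g b - g p with hb₂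
    set c₁ := f c - f p with hc₁
    set c₂ := g c - g p with hc₂
    have hb0 : b₁ < 0 := by linarith
    have hc0 : 0 < c₁ := by linarith
    have hpos' : 0 < c₁ * b₂ - b₁ * c₂ := by
      have : f p - f b = - b₁ := by ring
      rw [this] at hpos; linarith
    set K := (c₁ * (b₁ ^ 2 + b₂ ^ 2) - b₁ * (c₁ ^ 2 + c₂ ^ 2)) / (2 * (c₁ * b₂ - b₁ * c₂)) with hK
    refine (isCompact_Icc (a := ((((b₁ ^ 2 + b₂ ^ 2) / 2 + K * |b₂|) / b₁, 0) : ℝ × ℝ))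
      (b := ((((c₁ ^ 2 + c₂ ^ 2) / 2 + K * |c₂|) / c₁, K) : ℝ × ℝ))).of_isClosed_subset hclosed ?_
    rintro ⟨x, y⟩ ⟨hz, hy⟩
    have hzb := hz b hb
    have hzc := hz c hc
    simp only at hzb hzc hy
    rw [← hb₁, ← hb₂] at hzb
    rw [← hc₁, ← hc₂] at hzc
    have hyK : y ≤ K := by
      rw [hK, le_div_iff₀ (by linarith)]
      nlinarith [mul_le_mul_of_nonneg_left hzb hc0.le,
        mul_le_mul_of_nonneg_left hzc (neg_pos.mpr hb0).le]
    have habs : ∀ u : ℝ, - (K * |u|) ≤ y * u := by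
      intro u
      have h1 : y * |u| ≤ K * |u| := mul_le_mul_of_nonneg_right hyK (abs_nonneg u)
      have h2 : y * (- |u|) ≤ y * u := mul_le_mul_of_nonneg_left (neg_abs_le u) hy
      linarith
    refine ⟨⟨?_, hy⟩, ⟨?_, hyK⟩⟩
    · change _ / b₁ ≤ x
      rw [div_le_iff_of_neg hb0]
      linarith [habs b₂]
    · change x ≤ _ / c₁
      rw [le_div_iff₀ hc0]
      linarith [habs c₂]
  have hne : D.Nonempty := ⟨(0, 0), fun q _ => by
    simp only
    nlinarith [sq_nonneg (f q - f p), sq_nonneg (g q - g p)],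
    le_rfl⟩
  obtain ⟨z, ⟨hz, hz0⟩, hmax⟩ := hcompact.exists_isMaxOn hne continuous_snd.continuousOn
  refine ⟨z, hz, ?_⟩
  by_contra hno
  obtain ⟨t, ht⟩ := exists_slope_of_not_isBelowChord (hs.subset (Set.sep_subset _ _))
    (fun q hq => hf q hq.1) hno
  have hev : ∀ᶠ ε in nhdsWithin (0 : ℝ) (Set.Ioi 0), ∀ q ∈ s,
      2 * ((z.1 - ε * t) * (f q - f p) + (z.2 + ε) * (g q - g p)) ≤
        (f q - f p) ^ 2 + (g q - g p) ^ 2 := by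
    rw [Filter.eventually_all_finite hs]
    intro q hq
    rcases (hz q hq).eq_or_lt with heq | hlt
    · filter_upwards [self_mem_nhdsWithin] with ε hε
      have := mul_le_mul_of_nonneg_left (ht q ⟨hq, heq⟩) (le_of_lt hε)
      linarith
    · refine Filter.Eventually.filter_mono nhdsWithin_le_nhds ?_
      have hcont : Continuous fun ε : ℝ =>
          2 * ((z.1 - ε * t) * (f q - f p) + (z.2 + ε) * (g q - g p)) := by fun_prop
      refine ((hcont.tendsto 0).eventually_lt_const (by simpa using hlt)).mono fun ε h => h.le
  obtain ⟨ε, hε, hε0⟩ := (hev.and self_mem_nhdsWithin).exists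
  have hε0' : 0 < ε := hε0
  have : z.2 + ε ≤ z.2 := hmax (a := (z.1 - ε * t, z.2 + ε)) ⟨hε, by simp only; linarith⟩
  linarith

/-- A linear coordinate on the plane. -/
def horiz (α : ℝ) (x : Plane) : ℝ := x 0 + α * x 1

/-- The linear coordinate orthogonal to `horiz α`, oriented by the sign `σ`. -/
def vert (α σ : ℝ) (x : Plane) : ℝ := σ * (x 1 - α * x 0)

lemma exists_injOn_horiz {P : Set Plane} (hP : P.Finite) : ∃ α : ℝ, Set.InjOn (horiz α) P := by
  obtain ⟨α, hα⟩ := ((hP.prod hP).image fun z : Plane × Plane =>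
    -(z.1 0 - z.2 0) / (z.1 1 - z.2 1)).exists_notMem
  refine ⟨α, fun p hp q hq hpq => ?_⟩
  unfold horiz at hpq
  by_cases h1 : p 1 = q 1
  · ext i
    fin_cases i
    · rw [h1] at hpq; simpa using hpq
    · exact h1
  · refine (hα ⟨(p, q), ⟨hp, hq⟩, ?_⟩).elim
    have : p 1 - q 1 ≠ 0 := sub_ne_zero.mpr h1
    simp only
    rw [div_eq_iff this]
    linarith

lemma exists_horiz_vert_eq (α : ℝ) {σ : ℝ} (hσ : σ ^ 2 = 1) (X Y : ℝ) :
    ∃ x : Plane, horiz α x = X ∧ vert α σ x = Y := by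
  have h0 : 1 + α ^ 2 ≠ 0 := by positivity
  refine ⟨!₂[(X - α * (σ * Y)) / (1 + α ^ 2), (σ * Y + α * X) / (1 + α ^ 2)], ?_, ?_⟩
  · simp [horiz]; field_simp; ring
  · simp [vert]; field_simp; linear_combination (1 + α ^ 2) * Y * hσ

lemma eq_of_horiz_vert (α : ℝ) {σ : ℝ} (hσ : σ ^ 2 = 1) {x y : Plane}
    (h : horiz α x = horiz α y) (h' : vert α σ x = vert α σ y) : x = y := by
  unfold horiz at h
  unfold vert at h'
  have h0 : 1 + α ^ 2 ≠ 0 := by positivity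
  have h2 : x 1 - α * x 0 = y 1 - α * y 0 := by
    linear_combination σ * h' - (x 1 - α * x 0 - y 1 + α * y 0) * hσ
  ext i
  fin_cases i
  · refine mul_left_cancel₀ h0 ?_
    simp only [Fin.zero_eta]
    linear_combination h - α * h2
  · refine mul_left_cancel₀ h0 ?_
    simp only [Fin.mk_one]
    linear_combination h2 + α * h

lemma dist_le_dist_iff (α : ℝ) {σ : ℝ} (hσ : σ ^ 2 = 1) (x p q : Plane) :
    dist x p ≤ dist x q ↔
      2 * ((horiz α x - horiz α p) * (horiz α q - horiz α p) +
        (vert α σ x - vert α σ p) * (vert α σ q - vert α σ p)) ≤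
      (horiz α q - horiz α p) ^ 2 + (vert α σ q - vert α σ p) ^ 2 := by
  have h0 : 0 < 1 + α ^ 2 := by positivity
  rw [EuclideanSpace.dist_eq, EuclideanSpace.dist_eq, Real.sqrt_le_sqrt_iff (by positivity)]
  simp only [Fin.sum_univ_two, Real.dist_eq, sq_abs]
  rw [← mul_le_mul_iff_right₀ h0, ← sub_nonneg, ← sub_nonneg (b := 2 * _)]
  unfold horiz vert
  have : ∀ a b : ℝ, a = b → (0 ≤ a ↔ 0 ≤ b) := fun a b h => by rw [h]
  apply this
  have e (a b : ℝ) : (σ * a - σ * b) ^ 2 = (a - b) ^ 2 := by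
    linear_combination (a - b) ^ 2 * hσ
  have e' (a b c : ℝ) : (σ * a - σ * b) * (σ * c - σ * b) = (a - b) * (c - b) := by
    linear_combination (a - b) * (c - b) * hσ
  rw [e, e']
  ring

lemma dist_eq_dist_iff (α : ℝ) {σ : ℝ} (hσ : σ ^ 2 = 1) (x p q : Plane) :
    dist x p = dist x q ↔
      2 * ((horiz α x - horiz α p) * (horiz α q - horiz α p) +
        (vert α σ x - vert α σ p) * (vert α σ q - vert α σ p)) =
      (horiz α q - horiz α p) ^ 2 + (vert α σ q - vert α σ p) ^ 2 := by
  constructor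
  · intro h
    have h1 := (dist_le_dist_iff α hσ x p q).1 h.le
    have h2 := (dist_le_dist_iff α hσ x q p).1 h.ge
    linarith
  · intro h
    refine le_antisymm ((dist_le_dist_iff α hσ x p q).2 h.le)
      ((dist_le_dist_iff α hσ x q p).2 ?_)
    linarith

/-- `x` is the highest point (for the orientation `σ`) of the Voronoi cell of `p`, in the sense
that it is equidistant from `p` and from the ends of a chord above `p`. -/
def IsCellTop (α σ : ℝ) (P : Set Plane) (p x : Plane) : Prop :=
  p ∈ nearest P x ∧ IsBelowChord (horiz α) (vert α σ) (nearest P x) p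

lemma dist_eq_of_mem_nearest {P : Set Plane} {x p q : Plane} (hp : p ∈ nearest P x)
    (hq : q ∈ nearest P x) : dist x p = dist x q :=
  le_antisymm (hp.2 q hq.1) (hq.2 p hp.1)

lemma exists_isCellTop {P : Set Plane} (hP : P.Finite) {α σ : ℝ} (hσ : σ ^ 2 = 1)
    (hα : Set.InjOn (horiz α) P) {p : Plane} (hp : p ∈ P)
    (h : IsBelowChord (horiz α) (vert α σ) P p) : ∃ x, IsCellTop α σ P p x := by
  obtain ⟨z, hz, hchord⟩ := exists_highest_of_isBelowChord hP (fun q hq e => hα hq hp e) h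
  obtain ⟨x, hx1, hx2⟩ := exists_horiz_vert_eq α hσ (horiz α p + z.1) (vert α σ p + z.2)
  have e1 : horiz α x - horiz α p = z.1 := by linarith
  have e2 : vert α σ x - vert α σ p = z.2 := by linarith
  have hpx : ∀ q ∈ P, dist x p ≤ dist x q := by
    intro q hq
    rw [dist_le_dist_iff α hσ, e1, e2]
    exact hz q hq
  have hsub : ∀ q ∈ P, 2 * (z.1 * (horiz α q - horiz α p) + z.2 * (vert α σ q - vert α σ p)) =
      (horiz α q - horiz α p) ^ 2 + (vert α σ q - vert α σ p) ^ 2 → q ∈ nearest P x := by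
    intro q hq e
    rw [← e1, ← e2, ← dist_eq_dist_iff α hσ] at e
    exact ⟨hq, fun r hr => e ▸ hpx r hr⟩
  obtain ⟨b, hb, c, hc, hbc⟩ := hchord
  exact ⟨x, ⟨hp, hpx⟩, b, hsub b hb.1 hb.2, c, hsub c hc.1 hc.2, hbc⟩

lemma IsCellTop.isBelowChord {α σ : ℝ} {P : Set Plane} {p x : Plane} (h : IsCellTop α σ P p x) :
    IsBelowChord (horiz α) (vert α σ) P p := by
  obtain ⟨-, b, hb, c, hc, hbc⟩ := h
  exact ⟨b, hb.1, c, hc.1, hbc⟩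

lemma IsCellTop.vert_le {α σ : ℝ} (hσ : σ ^ 2 = 1) {P : Set Plane} {p x y : Plane}
    (hx : IsCellTop α σ P p x) (hy : p ∈ nearest P y) :
    vert α σ y ≤ vert α σ x ∧ (vert α σ y = vert α σ x → horiz α y = horiz α x) := by
  obtain ⟨hp, b, hb, c, hc, hbp, hpc, hpos⟩ := hx
  have xb := (dist_eq_dist_iff α hσ x p b).1 (dist_eq_of_mem_nearest hp hb)
  have xc := (dist_eq_dist_iff α hσ x p c).1 (dist_eq_of_mem_nearest hp hc)
  have yb := (dist_le_dist_iff α hσ y p b).1 (hy.2 b hb.1)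
  have yc := (dist_le_dist_iff α hσ y p c).1 (hy.2 c hc.1)
  have kb : (horiz α y - horiz α x) * (horiz α b - horiz α p) +
      (vert α σ y - vert α σ x) * (vert α σ b - vert α σ p) ≤ 0 := by linarith
  have kc : (horiz α y - horiz α x) * (horiz α c - horiz α p) +
      (vert α σ y - vert α σ x) * (vert α σ c - vert α σ p) ≤ 0 := by linarith
  constructor
  · have h1 := mul_nonpos_of_nonneg_of_nonpos (sub_pos.2 hpc).le kb
    have h2 := mul_nonpos_of_nonneg_of_nonpos (sub_pos.2 hbp).le kc
    have h3 : (vert α σ y - vert α σ x) * ((horiz α c - horiz α p) * (vert α σ b - vert α σ p) +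
        (horiz α p - horiz α b) * (vert α σ c - vert α σ p)) ≤ 0 := by linarith
    by_contra! hlt
    have := mul_pos (sub_pos.2 hlt) hpos
    linarith
  · intro e
    rw [e] at kb kc
    refine le_antisymm ?_ ?_
    · by_contra! hlt
      have := mul_pos (sub_pos.2 hlt) (sub_pos.2 hpc)
      linarith
    · by_contra! hlt
      have := mul_pos (sub_pos.2 hlt) (sub_pos.2 hbp)
      linarith

lemma IsCellTop.eq {α σ : ℝ} (hσ : σ ^ 2 = 1) {P : Set Plane} {p x y : Plane}
    (hx : IsCellTop α σ P p x) (hy : IsCellTop α σ P p y) : x = y := by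
  have h := le_antisymm (hy.vert_le hσ hx.1).1 (hx.vert_le hσ hy.1).1
  exact eq_of_horiz_vert α hσ ((hy.vert_le hσ hx.1).2 h) h

lemma IsCellTop.mem_vtx {α σ : ℝ} {P : Set Plane} {p x : Plane} (h : IsCellTop α σ P p x) :
    x ∈ vtx P := by
  obtain ⟨hp, b, hb, c, hc, hbp, hpc, -⟩ := h
  have h3 : ({b, p, c} : Set Plane).encard = 3 := by
    rw [Set.encard_eq_three]
    refine ⟨b, p, c, ?_, ?_, ?_, rfl⟩ <;> rintro rfl <;> linarith
  refine h3.symm.le.trans (Set.encard_le_encard ?_)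
  rintro q (rfl | rfl | rfl) <;> assumption

lemma vert_neg (α σ : ℝ) (x : Plane) : vert α (-σ) x = - vert α σ x := by
  unfold vert; ring

lemma exists_isCellTop_of_mem_vtx {P : Set Plane} {α : ℝ} (hα : Set.InjOn (horiz α) P) {x : Plane}
    (hx : x ∈ vtx P) : ∃ p σ, (σ = 1 ∨ σ = -1) ∧ IsCellTop α σ P p x := by
  obtain ⟨t, htN, ht⟩ := Set.exists_subset_encard_eq (show 3 ≤ (nearest P x).encard from hx)
  obtain ⟨b, p, c, hbp, hbc, hpc, rfl⟩ := Set.encard_eq_three.1 ht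
  obtain ⟨b, p, c, hb, hp, hc, hbp, hpc⟩ : ∃ b p c, b ∈ nearest P x ∧ p ∈ nearest P x ∧
      c ∈ nearest P x ∧ horiz α b < horiz α p ∧ horiz α p < horiz α c := by
    have hb : b ∈ nearest P x := htN (by simp)
    have hp : p ∈ nearest P x := htN (by simp)
    have hc : c ∈ nearest P x := htN (by simp)
    have h1 : horiz α b ≠ horiz α p := fun h => hbp (hα hb.1 hp.1 h)
    have h2 : horiz α b ≠ horiz α c := fun h => hbc (hα hb.1 hc.1 h)
    have h3 : horiz α p ≠ horiz α c := fun h => hpc (hα hp.1 hc.1 h)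
    rcases lt_or_gt_of_ne h1 with h1 | h1 <;> rcases lt_or_gt_of_ne h2 with h2 | h2 <;>
      rcases lt_or_gt_of_ne h3 with h3 | h3
    · exact ⟨b, p, c, hb, hp, hc, h1, h3⟩
    · exact ⟨b, c, p, hb, hc, hp, h2, h3⟩
    · exact absurd h1 (by linarith)
    · exact ⟨c, b, p, hc, hb, hp, h2, h1⟩
    · exact ⟨p, b, c, hp, hb, hc, h1, h2⟩
    · exact absurd h1 (by linarith)
    · exact ⟨p, c, b, hp, hc, hb, h3, h2⟩
    · exact ⟨c, p, b, hc, hp, hb, h3, h1⟩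
  rcases lt_trichotomy 0 ((horiz α c - horiz α p) * (vert α 1 b - vert α 1 p) +
    (horiz α p - horiz α b) * (vert α 1 c - vert α 1 p)) with h | h | h
  · exact ⟨p, 1, Or.inl rfl, hp, b, hb, c, hc, hbp, hpc, h⟩
  · have xb := (dist_eq_dist_iff α (one_pow 2) x p b).1 (dist_eq_of_mem_nearest hp hb)
    have xc := (dist_eq_dist_iff α (one_pow 2) x p c).1 (dist_eq_of_mem_nearest hp hc)
    have hb0 : 0 < horiz α p - horiz α b := by linarith
    have hc0 : 0 < horiz α c - horiz α p := by linarith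
    have hsum : (horiz α c - horiz α p) *
          ((horiz α b - horiz α p) ^ 2 + (vert α 1 b - vert α 1 p) ^ 2) +
        (horiz α p - horiz α b) *
          ((horiz α c - horiz α p) ^ 2 + (vert α 1 c - vert α 1 p) ^ 2) = 0 := by
      rw [← xb, ← xc]
      linear_combination (-2) * (vert α 1 x - vert α 1 p) * h
    have h1 : 0 < (horiz α c - horiz α p) *
        ((horiz α b - horiz α p) ^ 2 + (vert α 1 b - vert α 1 p) ^ 2) := by
      have : horiz α b - horiz α p ≠ 0 := by linarith
      positivity
    have h2 : 0 ≤ (horiz α p - horiz α b) *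
        ((horiz α c - horiz α p) ^ 2 + (vert α 1 c - vert α 1 p) ^ 2) := by positivity
    linarith
  · refine ⟨p, -1, Or.inr rfl, hp, b, hb, c, hc, hbp, hpc, ?_⟩
    simp only [vert_neg]
    linarith

lemma IsCellTop.unique {α σ σ' : ℝ} {P : Set Plane} {p p' x : Plane}
    (hσ : σ = 1 ∨ σ = -1) (hσ' : σ' = 1 ∨ σ' = -1) (hN : (nearest P x).ncard = 3)
    (h : IsCellTop α σ P p x) (h' : IsCellTop α σ' P p' x) : p = p' ∧ σ = σ' := by
  obtain ⟨hp, b, hb, c, hc, hbp, hpc, hpos⟩ := h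
  obtain ⟨hp', b', hb', c', hc', hbp', hpc', hpos'⟩ := h'
  have h3 : ({b, p, c} : Set Plane).ncard = 3 := by
    rw [Set.ncard_eq_three]
    refine ⟨b, p, c, ?_, ?_, ?_, rfl⟩ <;> rintro rfl <;> linarith
  have hNeq : ({b, p, c} : Set Plane) = nearest P x := by
    refine Set.eq_of_subset_of_ncard_le ?_ (by rw [hN, h3]) (Set.finite_of_ncard_ne_zero (by omega))
    rintro q (rfl | rfl | rfl) <;> assumption
  rw [← hNeq] at hp' hb' hc'
  have hpp : p' = p := by
    rcases hp' with rfl | rfl | rfl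
    · rcases hb' with rfl | rfl | rfl <;> linarith
    · rfl
    · rcases hc' with rfl | rfl | rfl <;> linarith
  subst hpp
  have hbb : b' = b := by
    rcases hb' with rfl | rfl | rfl
    · rfl
    · linarith
    · linarith
  have hcc : c' = c := by
    rcases hc' with rfl | rfl | rfl
    · linarith
    · linarith
    · rfl
  subst hbb hcc
  refine ⟨rfl, ?_⟩
  rcases hσ with rfl | rfl <;> rcases hσ' with rfl | rfl <;>
    first | rfl | (simp only [vert_neg] at hpos hpos'; linarith)

/-- Without cocircularities, Voronoi vertices correspond to highest and lowest points of cells. -/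
lemma ncard_vtx {P : Set Plane} (hP : P.Finite) {α : ℝ} (hα : Set.InjOn (horiz α) P)
    (hic : Ic P = 0) :
    (vtx P).ncard = {p ∈ P | IsBelowChord (horiz α) (vert α 1) P p}.ncard +
      {p ∈ P | IsBelowChord (horiz α) (vert α (-1)) P p}.ncard := by
  set S : ℝ → Set Plane := fun σ => {p ∈ P | IsBelowChord (horiz α) (vert α σ) P p} with hS
  have hSfin (σ : ℝ) : (S σ).Finite := hP.subset (Set.sep_subset _ _)
  have hex : ∀ z : Plane × ℝ, ∃ x, z.1 ∈ S z.2 → (z.2 = 1 ∨ z.2 = -1) → IsCellTop α z.2 P z.1 x := by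
    intro z
    by_cases h : z.1 ∈ S z.2 ∧ (z.2 = 1 ∨ z.2 = -1)
    · obtain ⟨x, hx⟩ := exists_isCellTop hP (sq_eq_one_iff.2 h.2) hα h.1.1 h.1.2
      exact ⟨x, fun _ _ => hx⟩
    · exact ⟨0, fun h1 h2 => (h ⟨h1, h2⟩).elim⟩
  choose F hF using hex
  set T : Set (Plane × ℝ) := S 1 ×ˢ {1} ∪ S (-1) ×ˢ {-1} with hT
  have hTfin : T.Finite := ((hSfin 1).prod (Set.finite_singleton _)).union
    ((hSfin (-1)).prod (Set.finite_singleton _))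
  have hTmem : ∀ z, z ∈ T ↔ z.1 ∈ S z.2 ∧ (z.2 = 1 ∨ z.2 = -1) := by
    rintro ⟨p, σ⟩
    simp only [hT, Set.mem_union, Set.mem_prod, Set.mem_singleton_iff]
    constructor
    · rintro (⟨h, rfl⟩ | ⟨h, rfl⟩)
      · exact ⟨h, Or.inl rfl⟩
      · exact ⟨h, Or.inr rfl⟩
    · rintro ⟨h, rfl | rfl⟩
      · exact Or.inl ⟨h, rfl⟩
      · exact Or.inr ⟨h, rfl⟩
  have hFT : ∀ z ∈ T, IsCellTop α z.2 P z.1 (F z) := fun z hz =>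
    hF z ((hTmem z).1 hz).1 ((hTmem z).1 hz).2
  have himage : F '' T = vtx P := by
    refine Set.Subset.antisymm ?_ fun x hx => ?_
    · rintro _ ⟨z, hz, rfl⟩
      exact (hFT z hz).mem_vtx
    · obtain ⟨p, σ, hσ, h⟩ := exists_isCellTop_of_mem_vtx hα hx
      have hz : (p, σ) ∈ T := (hTmem _).2 ⟨⟨h.1.1, h.isBelowChord⟩, hσ⟩
      exact ⟨(p, σ), hz, (hFT _ hz).eq (sq_eq_one_iff.2 hσ) h⟩
  have hVfin : (vtx P).Finite := himage ▸ hTfin.image F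
  have hN : ∀ x ∈ vtx P, (nearest P x).ncard = 3 := by
    have hge : ∀ x ∈ vtx P, (0 : ℤ) ≤ (nearest P x).ncard - 3 := by
      intro x hx
      have hfin : (nearest P x).Finite := hP.subset (Set.sep_subset _ _)
      have h3 : 3 ≤ (nearest P x).encard := hx
      rw [← hfin.cast_ncard_eq] at h3
      have : 3 ≤ (nearest P x).ncard := by exact_mod_cast h3
      omega
    intro x hx
    unfold Ic at hic
    rw [finsum_mem_eq_finite_toFinset_sum _ hVfin, Finset.sum_eq_zero_iff_of_nonneg
      (fun x hx => hge x (hVfin.mem_toFinset.1 hx))] at hic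
    have := hic x (hVfin.mem_toFinset.2 hx)
    omega
  have hinj : Set.InjOn F T := by
    intro z hz w hw e
    have h1 := hFT z hz
    have h2 := hFT w hw
    rw [← e] at h2
    obtain ⟨h3, h4⟩ := IsCellTop.unique ((hTmem z).1 hz).2 ((hTmem w).1 hw).2 (hN _ h1.mem_vtx) h1 h2
    exact Prod.ext h3 h4
  rw [← himage, hinj.ncard_image, hT, Set.ncard_union_eq ?_
    ((hSfin 1).prod (Set.finite_singleton _)) ((hSfin (-1)).prod (Set.finite_singleton _)),
    Set.ncard_prod, Set.ncard_prod, Set.ncard_singleton, Set.ncard_singleton, mul_one, mul_one]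
  rw [Set.disjoint_left]
  rintro ⟨p, σ⟩ ⟨-, h1⟩ ⟨-, h2⟩
  simp only [Set.mem_singleton_iff] at h1 h2
  linarith

lemma isBelowChord_of_mem_interior {P : Set Plane} (hP : P.Finite) {α σ : ℝ} (hσ : σ ^ 2 = 1)
    (hα : Set.InjOn (horiz α) P) {p : Plane} (hp : p ∈ P)
    (h : p ∈ interior (convexHull ℝ P)) : IsBelowChord (horiz α) (vert α σ) P p := by
  by_contra hno
  obtain ⟨t, ht⟩ := exists_slope_of_not_isBelowChord hP (fun q hq e => hα hq hp e) hno
  have hhull : ∀ x ∈ convexHull ℝ P,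
      vert α σ x - vert α σ p ≤ t * (horiz α x - horiz α p) := by
    have hconv : Convex ℝ {x | vert α σ x - vert α σ p ≤ t * (horiz α x - horiz α p)} := by
      intro x hx y hy a b ha hb hab
      simp only [Set.mem_ofPred_eq, horiz, vert, PiLp.add_apply, PiLp.smul_apply,
        smul_eq_mul] at hx hy ⊢
      obtain rfl : b = 1 - a := by linarith
      linarith [mul_le_mul_of_nonneg_left hx ha, mul_le_mul_of_nonneg_left hy hb]
    exact fun x hx => convexHull_min ht hconv hx
  obtain ⟨d, hd1, hd2⟩ := exists_horiz_vert_eq α hσ 0 1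
  have hev : ∀ᶠ ε in nhdsWithin (0 : ℝ) (Set.Ioi 0), p + ε • d ∈ interior (convexHull ℝ P) := by
    refine Filter.Eventually.filter_mono nhdsWithin_le_nhds ?_
    have hcont : Continuous fun ε : ℝ => p + ε • d := by fun_prop
    exact (hcont.tendsto 0).eventually_mem (isOpen_interior.mem_nhds (by simpa using h))
  obtain ⟨ε, hε, hε0⟩ := (hev.and self_mem_nhdsWithin).exists
  have hε0' : 0 < ε := hε0
  have key := hhull _ (interior_subset hε)
  have e1 : horiz α (p + ε • d) = horiz α p := by
    have : horiz α (p + ε • d) = horiz α p + ε * horiz α d := by simp [horiz]; ring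
    rw [this, hd1]; ring
  have e2 : vert α σ (p + ε • d) = vert α σ p + ε := by
    have : vert α σ (p + ε • d) = vert α σ p + ε * vert α σ d := by simp [vert]; ring
    rw [this, hd2]; ring
  rw [e1, e2] at key
  linarith

lemma mem_interior_of_isBelowChord {P : Set Plane} {α : ℝ}
    (hne : (interior (convexHull ℝ P)).Nonempty) {p : Plane}
    (h : IsBelowChord (horiz α) (vert α 1) P p)
    (h' : IsBelowChord (horiz α) (vert α (-1)) P p) : p ∈ interior (convexHull ℝ P) := by
  by_contra hp
  have hconv := convex_convexHull ℝ P
  obtain ⟨φ, hφ⟩ := geometric_hahn_banach_open_point hconv.interior isOpen_interior hp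
  have hle : ∀ q ∈ P, φ q ≤ φ p := by
    intro q hq
    have hq' : q ∈ closure (interior (convexHull ℝ P)) := by
      rw [hconv.closure_interior_eq_closure_of_nonempty_interior hne]
      exact subset_closure (subset_convexHull ℝ P hq)
    exact closure_minimal (fun x hx => (hφ x hx).le)
      (isClosed_le φ.continuous continuous_const) hq'
  obtain ⟨β, γ, hβγ⟩ : ∃ β γ : ℝ, ∀ x, φ x = β * horiz α x + γ * vert α 1 x := by
    have h0 : 1 + α ^ 2 ≠ 0 := by positivity
    refine ⟨(φ (EuclideanSpace.single 0 1) + α * φ (EuclideanSpace.single 1 1)) / (1 + α ^ 2),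
      (φ (EuclideanSpace.single 1 1) - α * φ (EuclideanSpace.single 0 1)) / (1 + α ^ 2),
      fun x => ?_⟩
    have hx : x = x 0 • EuclideanSpace.single (0 : Fin 2) (1 : ℝ) +
        x 1 • EuclideanSpace.single (1 : Fin 2) (1 : ℝ) := by
      ext i; fin_cases i <;> simp
    have hφx : φ x = x 0 * φ (EuclideanSpace.single 0 1) +
        x 1 * φ (EuclideanSpace.single 1 1) := by
      conv_lhs => rw [hx]
      simp
    rw [hφx]
    unfold horiz vert
    field_simp
    ring
  obtain ⟨b, hb, c, hc, hbp, hpc, hpos⟩ := h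
  obtain ⟨b', hb', c', hc', hbp', hpc', hpos'⟩ := h'
  have kb := hle b hb
  have kc := hle c hc
  have kb' := hle b' hb'
  have kc' := hle c' hc'
  simp only [vert_neg] at hpos'
  simp only [hβγ] at kb kc kb' kc'
  have k1 : γ * ((horiz α c - horiz α p) * (vert α 1 b - vert α 1 p) +
      (horiz α p - horiz α b) * (vert α 1 c - vert α 1 p)) ≤ 0 := by
    linarith [mul_le_mul_of_nonneg_left kb (sub_pos.2 hpc).le,
      mul_le_mul_of_nonneg_left kc (sub_pos.2 hbp).le]
  have k2 : 0 ≤ γ * ((horiz α c' - horiz α p) * (-vert α 1 b' - -vert α 1 p) +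
      (horiz α p - horiz α b') * (-vert α 1 c' - -vert α 1 p)) := by
    linarith [mul_le_mul_of_nonneg_left kb' (sub_pos.2 hpc').le,
      mul_le_mul_of_nonneg_left kc' (sub_pos.2 hbp').le]
  have hγ : γ = 0 := by
    refine le_antisymm ?_ ?_
    · by_contra! hlt
      linarith [mul_pos hlt hpos]
    · by_contra! hlt
      linarith [mul_neg_of_neg_of_pos hlt hpos']
  have hβ : β = 0 := by
    rw [hγ] at kb kc
    refine le_antisymm ?_ ?_
    · by_contra! hlt
      linarith [mul_lt_mul_of_pos_left hpc hlt]
    · by_contra! hlt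
      linarith [mul_lt_mul_of_neg_left hbp hlt]
  obtain ⟨y, hy⟩ := hne
  have := hφ y hy
  rw [hβγ, hβγ, hγ, hβ] at this
  linarith

/-- If some point is below a chord, any point strictly between two others horizontally is
below a chord or above one. -/
lemma isBelowChord_or_of_between {P : Set Plane} {α : ℝ} {r p b c : Plane}
    (hr : IsBelowChord (horiz α) (vert α 1) P r) (hrP : r ∈ P)
    (hα : Set.InjOn (horiz α) P) (hp : p ∈ P) (hb : b ∈ P) (hc : c ∈ P)
    (hbp : horiz α b < horiz α p) (hpc : horiz α p < horiz α c) :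
    IsBelowChord (horiz α) (vert α 1) P p ∨ IsBelowChord (horiz α) (vert α (-1)) P p := by
  by_contra! hno
  obtain ⟨hno1, hno2⟩ := hno
  have hzero : ∀ b ∈ P, ∀ c ∈ P, horiz α b < horiz α p → horiz α p < horiz α c →
      (horiz α c - horiz α p) * (vert α 1 b - vert α 1 p) +
        (horiz α p - horiz α b) * (vert α 1 c - vert α 1 p) = 0 := by
    intro b hb c hc hbp hpc
    refine le_antisymm ?_ ?_
    · by_contra! hlt
      exact hno1 ⟨b, hb, c, hc, hbp, hpc, hlt⟩
    · by_contra! hlt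
      refine hno2 ⟨b, hb, c, hc, hbp, hpc, ?_⟩
      simp only [vert_neg]
      linarith
  obtain ⟨s, hs⟩ : ∃ s, vert α 1 b - vert α 1 p = s * (horiz α b - horiz α p) :=
    ⟨(vert α 1 b - vert α 1 p) / (horiz α b - horiz α p),
      (div_mul_cancel₀ _ (by linarith)).symm⟩
  have hR : ∀ q ∈ P, horiz α p < horiz α q →
      vert α 1 q - vert α 1 p = s * (horiz α q - horiz α p) := by
    intro q hq hpq
    have h0 := hzero b hb q hq hbp hpq
    rw [hs] at h0
    refine mul_left_cancel₀ (sub_pos.2 hbp).ne' ?_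
    linarith
  have hall : ∀ q ∈ P, vert α 1 q - vert α 1 p = s * (horiz α q - horiz α p) := by
    intro q hq
    rcases lt_trichotomy (horiz α q) (horiz α p) with hlt | heq | hgt
    · have h0 := hzero q hq c hc hlt hpc
      rw [hR c hc hpc] at h0
      refine mul_left_cancel₀ (sub_pos.2 hpc).ne' ?_
      linarith
    · rw [hα hq hp heq]; ring
    · exact hR q hq hgt
  obtain ⟨b', hb', c', hc', -, -, hpos⟩ := hr
  have e1 : vert α 1 b' - vert α 1 r = s * (horiz α b' - horiz α r) := by
    linarith [hall b' hb', hall r hrP]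
  have e2 : vert α 1 c' - vert α 1 r = s * (horiz α c' - horiz α r) := by
    linarith [hall c' hc', hall r hrP]
  rw [e1, e2] at hpos
  linarith

theorem two_interior_no_cocircularity (P : Set Plane) (hP : P.Finite)
    (hint : (P \ Bd P).ncard = 2) (hic : Ic P = 0) :
    (vtx P).ncard = P.ncard := by
  obtain ⟨α, hα⟩ := exists_injOn_horiz hP
  set A := {p ∈ P | IsBelowChord (horiz α) (vert α 1) P p} with hA
  set B := {p ∈ P | IsBelowChord (horiz α) (vert α (-1)) P p} with hB
  have hAfin : A.Finite := hP.subset (Set.sep_subset _ _)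
  have hBfin : B.Finite := hP.subset (Set.sep_subset _ _)
  have hInt : ∀ p ∈ P, p ∈ P \ Bd P ↔ p ∈ interior (convexHull ℝ P) := by
    intro p hp
    have hcl : p ∈ closure (convexHull ℝ P) := subset_closure (subset_convexHull ℝ P hp)
    simp [Bd, frontier, hp, hcl, -closure_sdiff_interior]
  obtain ⟨r, hr⟩ : (P \ Bd P).Nonempty := Set.nonempty_of_ncard_ne_zero (by omega)
  have hrint := (hInt r hr.1).1 hr
  have hinter : A ∩ B = P \ Bd P := by
    ext p
    constructor
    · rintro ⟨⟨hp, h1⟩, -, h2⟩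
      exact (hInt p hp).2 (mem_interior_of_isBelowChord ⟨r, hrint⟩ h1 h2)
    · intro h
      have hp := (hInt p h.1).1 h
      exact ⟨⟨h.1, isBelowChord_of_mem_interior hP (by norm_num) hα h.1 hp⟩,
        h.1, isBelowChord_of_mem_interior hP (by norm_num) hα h.1 hp⟩
  have hrA := isBelowChord_of_mem_interior hP (σ := 1) (by norm_num) hα hr.1 hrint
  obtain ⟨m, hm, hmin⟩ := Set.exists_min_image P (horiz α) hP ⟨r, hr.1⟩
  obtain ⟨M, hM, hmax⟩ := Set.exists_max_image P (horiz α) hP ⟨r, hr.1⟩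
  have hmM : m ≠ M := by
    rintro rfl
    obtain ⟨b, hb, c, hc, hbr, hrc, -⟩ := hrA
    linarith [hmin b hb, hmax c hc]
  have hunion : A ∪ B = P \ {m, M} := by
    ext p
    constructor
    · have hside : ∀ σ, IsBelowChord (horiz α) (vert α σ) P p → p ∉ ({m, M} : Set Plane) := by
        rintro σ ⟨b, hb, c, hc, hbp, hpc, -⟩ (rfl | rfl)
        · linarith [hmin b hb]
        · linarith [hmax c hc]
      rintro (⟨hp, h⟩ | ⟨hp, h⟩) <;> exact ⟨hp, hside _ h⟩
    · rintro ⟨hp, hne⟩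
      simp only [Set.mem_insert_iff, Set.mem_singleton_iff, not_or] at hne
      have h1 : horiz α m < horiz α p :=
        lt_of_le_of_ne (hmin p hp) fun e => hne.1 (hα hm hp e).symm
      have h2 : horiz α p < horiz α M :=
        lt_of_le_of_ne (hmax p hp) fun e => hne.2 (hα hp hM e)
      exact (isBelowChord_or_of_between hrA hr.1 hα hp hm hM h1 h2).imp
        (fun h => ⟨hp, h⟩) (fun h => ⟨hp, h⟩)
  have hsub : ({m, M} : Set Plane) ⊆ P := by
    rintro q (rfl | rfl) <;> assumption
  have hcard := Set.ncard_union_add_ncard_inter A B hAfin hBfin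
  have hdiff := Set.ncard_sdiff_add_ncard_of_subset hsub hP
  rw [hunion, hinter, hint] at hcard
  rw [Set.ncard_pair hmM] at hdiff
  have hvtx : (vtx P).ncard = A.ncard + B.ncard := ncard_vtx hP hα hic
  omega
end

section
/- Let P be a finite subset of the Euclidean plane ℝ² and let N ∈ ℕ. Suppose that for every n with 0 ≤ n ≤ N−1, the set 𝒱^[n](P) is not collinear and I_c(𝒱^[n](P)) = 0. Then, as integers, (𝒱^[N](P)).ncard ≥ 2^N·(P.ncard) − (2^N − 1)·((Bd(P)).ncard + 2). -/
open Set

/-- From a point of the cell of `p` all of whose tight constraints lie on one side of `p`,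
one can move upwards inside the cell. -/
theorem exists_higher {ι : Type*} {S : Set ι} (hS : S.Finite) (X Y : ι → ℝ) {p : ι} (κ ξ η : ℝ)
    (hcell : ∀ q ∈ S, (ξ - X p) ^ 2 + (η - Y p) ^ 2 ≤ (ξ - X q) ^ 2 + (η - Y q) ^ 2)
    (htight : ∀ q ∈ S, q ≠ p →
      (ξ - X q) ^ 2 + (η - Y q) ^ 2 = (ξ - X p) ^ 2 + (η - Y p) ^ 2 → 0 < κ * (X q - X p)) :
    ∃ ξ' η' : ℝ, η < η' ∧
      ∀ q ∈ S, (ξ' - X p) ^ 2 + (η' - Y p) ^ 2 ≤ (ξ' - X q) ^ 2 + (η' - Y q) ^ 2 := by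
  obtain ⟨M, hM⟩ := (hS.image fun q => (Y q - Y p) / (κ * (X q - X p))).bddAbove
  have hM' : ∀ q ∈ S, (Y q - Y p) / (κ * (X q - X p)) ≤ M := fun q hq =>
    hM (Set.mem_image_of_mem _ hq)
  have key : ∀ᶠ ε : ℝ in nhdsWithin 0 (Set.Ioi 0), ∀ q ∈ S,
      (ξ - ε * (κ * M) - X p) ^ 2 + (η + ε - Y p) ^ 2 ≤
        (ξ - ε * (κ * M) - X q) ^ 2 + (η + ε - Y q) ^ 2 := by
    rw [Filter.eventually_all_finite hS]
    intro q hq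
    by_cases hqp : q = p
    · simp [hqp]
    rcases (hcell q hq).lt_or_eq with hlt | heq
    · have hf : ContinuousAt (fun ε : ℝ =>
          (ξ - ε * (κ * M) - X p) ^ 2 + (η + ε - Y p) ^ 2) 0 := by fun_prop
      have hg : ContinuousAt (fun ε : ℝ =>
          (ξ - ε * (κ * M) - X q) ^ 2 + (η + ε - Y q) ^ 2) 0 := by fun_prop
      have := hf.eventually_lt hg (by simpa using hlt)
      exact (this.filter_mono nhdsWithin_le_nhds).mono fun _ h => h.le
    · have hpos := htight q hq hqp heq.symm
      have h1 := (div_le_iff₀ hpos).1 (hM' q hq)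
      filter_upwards [self_mem_nhdsWithin] with ε hε
      have h2 := mul_le_mul_of_nonneg_left h1 (le_of_lt (Set.mem_Ioi.1 hε))
      nlinarith
  obtain ⟨ε, h, hε⟩ := (key.and self_mem_nhdsWithin).exists
  exact ⟨_, η + ε, by simpa using hε, h⟩

/-- If `p` lies strictly below a segment joining a point on its left to a point on its right, then
its cell has a highest vertex, which is equidistant from `p` and from points on both sides. -/
theorem exists_top {ι : Type*} {S : Set ι} (hS : S.Finite) (X Y : ι → ℝ) (hX : Set.InjOn X S)
    {p q₁ q₂ : ι} (hp : p ∈ S) (h₁ : q₁ ∈ S) (h₂ : q₂ ∈ S) (hl : X q₁ < X p) (hr : X p < X q₂)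
    (hup : 0 < (Y q₁ - Y p) * (X q₂ - X p) + (Y q₂ - Y p) * (X p - X q₁)) :
    ∃ ξ η : ℝ, Y p < η ∧
      (∀ q ∈ S, (ξ - X p) ^ 2 + (η - Y p) ^ 2 ≤ (ξ - X q) ^ 2 + (η - Y q) ^ 2) ∧
      (∃ q ∈ S, X q < X p ∧
        (ξ - X q) ^ 2 + (η - Y q) ^ 2 = (ξ - X p) ^ 2 + (η - Y p) ^ 2) ∧
      ∃ q ∈ S, X p < X q ∧
        (ξ - X q) ^ 2 + (η - Y q) ^ 2 = (ξ - X p) ^ 2 + (η - Y p) ^ 2 := by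
  set K : Set (ℝ × ℝ) := {z | Y p ≤ z.2 ∧
    ∀ q ∈ S, (z.1 - X p) ^ 2 + (z.2 - Y p) ^ 2 ≤ (z.1 - X q) ^ 2 + (z.2 - Y q) ^ 2} with hK
  have hclosed : IsClosed K := by
    refine IsClosed.inter (isClosed_le continuous_const continuous_snd) ?_
    have : {z : ℝ × ℝ | ∀ q ∈ S,
        (z.1 - X p) ^ 2 + (z.2 - Y p) ^ 2 ≤ (z.1 - X q) ^ 2 + (z.2 - Y q) ^ 2} =
        ⋂ q ∈ S, {z : ℝ × ℝ |
          (z.1 - X p) ^ 2 + (z.2 - Y p) ^ 2 ≤ (z.1 - X q) ^ 2 + (z.2 - Y q) ^ 2} := by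
      ext; simp
    change IsClosed {z : ℝ × ℝ | ∀ q ∈ S,
        (z.1 - X p) ^ 2 + (z.2 - Y p) ^ 2 ≤ (z.1 - X q) ^ 2 + (z.2 - Y q) ^ 2}
    rw [this]
    exact isClosed_biInter fun q _ => isClosed_le (by fun_prop) (by fun_prop)
  have hbdd : ∃ a b c d : ℝ, K ⊆ Set.Icc (a, b) (c, d) := by
    obtain ⟨D, hD⟩ : ∃ D, D = (Y q₁ - Y p) * (X q₂ - X p) + (Y q₂ - Y p) * (X p - X q₁) :=
      ⟨_, rfl⟩
    rw [← hD] at hup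
    obtain ⟨c₁, hc₁⟩ : ∃ c, c = (X q₁ - X p) ^ 2 + (Y q₁ - Y p) ^ 2 := ⟨_, rfl⟩
    obtain ⟨c₂, hc₂⟩ : ∃ c, c = (X q₂ - X p) ^ 2 + (Y q₂ - Y p) ^ 2 := ⟨_, rfl⟩
    obtain ⟨M, hM⟩ : ∃ M, M = ((X q₂ - X p) * c₁ + (X p - X q₁) * c₂) / (2 * D) := ⟨_, rfl⟩
    refine ⟨X p - (c₁ / 2 + |Y q₁ - Y p| * M) / (X p - X q₁), Y p,
      X p + (c₂ / 2 + |Y q₂ - Y p| * M) / (X q₂ - X p), Y p + M, ?_⟩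
    rintro ⟨x, y⟩ ⟨hy, hq⟩
    have e₁ := hq q₁ h₁
    have e₂ := hq q₂ h₂
    simp only at hy e₁ e₂
    have f₁ : 2 * ((X q₁ - X p) * (x - X p) + (Y q₁ - Y p) * (y - Y p)) ≤ c₁ := by
      rw [hc₁]; nlinarith
    have f₂ : 2 * ((X q₂ - X p) * (x - X p) + (Y q₂ - Y p) * (y - Y p)) ≤ c₂ := by
      rw [hc₂]; nlinarith
    have hyM : y - Y p ≤ M := by
      rw [hM, le_div_iff₀ (by positivity), hD]
      have g₁ := mul_le_mul_of_nonneg_left f₁ (sub_pos.2 hr).le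
      have g₂ := mul_le_mul_of_nonneg_left f₂ (sub_pos.2 hl).le
      linarith
    have hy0 : 0 ≤ y - Y p := by linarith
    have bnd : ∀ b : ℝ, -(b * (y - Y p)) ≤ |b| * M := fun b =>
      calc -(b * (y - Y p)) = -b * (y - Y p) := by ring
        _ ≤ |b| * (y - Y p) := mul_le_mul_of_nonneg_right (neg_le_abs b) hy0
        _ ≤ |b| * M := mul_le_mul_of_nonneg_left hyM (abs_nonneg b)
    have b₁ := bnd (Y q₁ - Y p)
    have b₂ := bnd (Y q₂ - Y p)
    refine ⟨⟨?_, hy⟩, ⟨?_, by simp only; linarith⟩⟩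
    · have : X p - x ≤ (c₁ / 2 + |Y q₁ - Y p| * M) / (X p - X q₁) := by
        rw [le_div_iff₀ (by linarith)]; linarith
      simp only; linarith
    · have : x - X p ≤ (c₂ / 2 + |Y q₂ - Y p| * M) / (X q₂ - X p) := by
        rw [le_div_iff₀ (by linarith)]; linarith
      simp only; linarith
  obtain ⟨a, b, c, d, hsub⟩ := hbdd
  have hcomp : IsCompact K := isCompact_Icc.of_isClosed_subset hclosed hsub
  have hpc : ∀ q ∈ S, (X p - X p) ^ 2 + (Y p - Y p) ^ 2 ≤ (X p - X q) ^ 2 + (Y p - Y q) ^ 2 := by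
    intro q _
    nlinarith [sq_nonneg (X p - X q), sq_nonneg (Y p - Y q)]
  obtain ⟨⟨ξ, η⟩, ⟨hη, hz⟩, hmax⟩ := hcomp.exists_isMaxOn (f := Prod.snd) ⟨(X p, Y p), le_rfl, hpc⟩
    continuous_snd.continuousOn
  simp only at hη hz
  have hmax' : ∀ ξ' η' : ℝ, Y p ≤ η' →
      (∀ q ∈ S, (ξ' - X p) ^ 2 + (η' - Y p) ^ 2 ≤ (ξ' - X q) ^ 2 + (η' - Y q) ^ 2) → η' ≤ η :=
    fun ξ' η' h h' => hmax (a := (ξ', η')) ⟨h, h'⟩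
  have side : ∀ κ : ℝ, κ ^ 2 = 1 → ∃ q ∈ S, 0 < κ * (X q - X p) ∧
      (ξ - X q) ^ 2 + (η - Y q) ^ 2 = (ξ - X p) ^ 2 + (η - Y p) ^ 2 := by
    intro κ hκ
    by_contra! hcon
    obtain ⟨ξ', η', hlt, h'⟩ := exists_higher hS X Y (p := p) (-κ) ξ η hz (by
      intro q hq hqp ht
      have h0 : ¬ 0 < κ * (X q - X p) := fun h => hcon q hq h ht
      have hκ0 : κ ≠ 0 := by rintro rfl; norm_num at hκ
      have hne : κ * (X q - X p) ≠ 0 :=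
        mul_ne_zero hκ0 (sub_ne_zero.2 fun h => hqp (hX hq hp h))
      have : κ * (X q - X p) < 0 := lt_of_le_of_ne (not_lt.1 h0) hne
      linarith)
    exact absurd (hmax' ξ' η' (by linarith) h') (not_le.2 hlt)
  refine ⟨ξ, η, ?_, hz, ?_, ?_⟩
  · obtain ⟨ξ', η', hlt, h'⟩ := exists_higher hS X Y (p := p) 1 (X p) (Y p) hpc (by
      intro q hq hqp ht
      have : X p - X q = 0 := by nlinarith [sq_nonneg (X p - X q), sq_nonneg (Y p - Y q)]
      exact absurd (hX hq hp (by linarith)) hqp)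
    exact hlt.trans_le (hmax' ξ' η' hlt.le h')
  · obtain ⟨q, hq, h, h'⟩ := side (-1) (by norm_num)
    exact ⟨q, hq, by linarith, h'⟩
  · obtain ⟨q, hq, h, h'⟩ := side 1 (by norm_num)
    exact ⟨q, hq, by linarith, h'⟩

theorem dist_le_dist_iff_coord (x p q : Plane) :
    dist x p ≤ dist x q ↔
      (x 0 - p 0) ^ 2 + (x 1 - p 1) ^ 2 ≤ (x 0 - q 0) ^ 2 + (x 1 - q 1) ^ 2 := by
  rw [EuclideanSpace.dist_eq, EuclideanSpace.dist_eq, Real.sqrt_le_sqrt_iff (by positivity)]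
  simp [Fin.sum_univ_two, Real.dist_eq, sq_abs]

theorem plane_ext {x y : Plane} (h0 : x 0 = y 0) (h1 : x 1 = y 1) : x = y := by
  ext i; fin_cases i <;> assumption

theorem mem_nearest_iff {P : Set Plane} {x p : Plane} :
    p ∈ nearest P x ↔ p ∈ P ∧ ∀ q ∈ P,
      (x 0 - p 0) ^ 2 + (x 1 - p 1) ^ 2 ≤ (x 0 - q 0) ^ 2 + (x 1 - q 1) ^ 2 := by
  simp [nearest, dist_le_dist_iff_coord]

theorem eq_of_mem_nearest {P : Set Plane} {x p q : Plane} (hp : p ∈ nearest P x)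
    (hq : q ∈ nearest P x) :
    (x 0 - p 0) ^ 2 + (x 1 - p 1) ^ 2 = (x 0 - q 0) ^ 2 + (x 1 - q 1) ^ 2 :=
  le_antisymm ((mem_nearest_iff.1 hp).2 q (mem_nearest_iff.1 hq).1)
    ((mem_nearest_iff.1 hq).2 p (mem_nearest_iff.1 hp).1)

/-- Twice the signed area of the triangle `a b c`. -/
def cross (a b c : Plane) : ℝ :=
  (b 0 - a 0) * (c 1 - a 1) - (b 1 - a 1) * (c 0 - a 0)

theorem exists_mul_of_cross_eq_zero {a b c : Plane} (hab : a ≠ b) (h : cross a b c = 0) :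
    ∃ k : ℝ, c 0 - a 0 = k * (b 0 - a 0) ∧ c 1 - a 1 = k * (b 1 - a 1) := by
  unfold cross at h
  by_cases h0 : b 0 - a 0 = 0
  · have h1 : b 1 - a 1 ≠ 0 := fun h1 => hab (plane_ext (by linarith) (by linarith))
    refine ⟨(c 1 - a 1) / (b 1 - a 1), ?_, by field_simp⟩
    rw [h0] at h ⊢
    have : (b 1 - a 1) * (c 0 - a 0) = 0 := by linarith
    simpa [h1] using this
  · refine ⟨(c 0 - a 0) / (b 0 - a 0), by field_simp, ?_⟩
    field_simp; linarith

theorem collinear_of_cross_eq_zero {P : Set Plane} {a b : Plane} (hab : a ≠ b)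
    (h : ∀ q ∈ P, cross a b q = 0) : Collinear ℝ P := by
  rw [collinear_iff_exists_forall_eq_smul_vadd]
  refine ⟨a, b - a, fun q hq => ?_⟩
  obtain ⟨k, h0, h1⟩ := exists_mul_of_cross_eq_zero hab (h q hq)
  refine ⟨k, plane_ext ?_ ?_⟩ <;> simp <;> linarith

theorem cross_ne_zero_of_equidistant {v a b c : Plane} (hab : a ≠ b) (hac : a ≠ c) (hbc : b ≠ c)
    (h1 : (v 0 - a 0) ^ 2 + (v 1 - a 1) ^ 2 = (v 0 - b 0) ^ 2 + (v 1 - b 1) ^ 2)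
    (h2 : (v 0 - a 0) ^ 2 + (v 1 - a 1) ^ 2 = (v 0 - c 0) ^ 2 + (v 1 - c 1) ^ 2) :
    cross a b c ≠ 0 := by
  intro h
  obtain ⟨k, e0, e1⟩ := exists_mul_of_cross_eq_zero hab h
  have hc0 : c 0 = a 0 + k * (b 0 - a 0) := by linarith
  have hc1 : c 1 = a 1 + k * (b 1 - a 1) := by linarith
  have hpos : (b 0 - a 0) ^ 2 + (b 1 - a 1) ^ 2 ≠ 0 := by
    intro h0
    exact hab (plane_ext (by nlinarith [sq_nonneg (b 0 - a 0), sq_nonneg (b 1 - a 1)])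
      (by nlinarith [sq_nonneg (b 0 - a 0), sq_nonneg (b 1 - a 1)]))
  rw [hc0, hc1] at h2
  have : k * (k - 1) * ((b 0 - a 0) ^ 2 + (b 1 - a 1) ^ 2) = 0 := by linear_combination k * h1 - h2
  rcases mul_eq_zero.1 this with h3 | h3
  · rcases mul_eq_zero.1 h3 with h4 | h4
    · exact hac (plane_ext (by rw [hc0, h4]; ring) (by rw [hc1, h4]; ring))
    · have : k = 1 := by linarith
      exact hbc (plane_ext (by rw [hc0, this]; ring) (by rw [hc1, this]; ring))
  · exact hpos h3

theorem eq_of_equidistant {v w a b c : Plane} (hcr : cross a b c ≠ 0)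
    (h1 : (v 0 - a 0) ^ 2 + (v 1 - a 1) ^ 2 = (v 0 - b 0) ^ 2 + (v 1 - b 1) ^ 2)
    (h2 : (v 0 - a 0) ^ 2 + (v 1 - a 1) ^ 2 = (v 0 - c 0) ^ 2 + (v 1 - c 1) ^ 2)
    (h3 : (w 0 - a 0) ^ 2 + (w 1 - a 1) ^ 2 = (w 0 - b 0) ^ 2 + (w 1 - b 1) ^ 2)
    (h4 : (w 0 - a 0) ^ 2 + (w 1 - a 1) ^ 2 = (w 0 - c 0) ^ 2 + (w 1 - c 1) ^ 2) : v = w := by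
  have e0 : cross a b c * (v 0 - w 0) = 0 := by
    unfold cross
    linear_combination ((c 1 - a 1) * (h1 - h3) - (b 1 - a 1) * (h2 - h4)) / 2
  have e1 : cross a b c * (v 1 - w 1) = 0 := by
    unfold cross
    linear_combination ((b 0 - a 0) * (h2 - h4) - (c 0 - a 0) * (h1 - h3)) / 2
  refine plane_ext ?_ ?_
  · have := (mul_eq_zero.1 e0).resolve_left hcr; linarith
  · have := (mul_eq_zero.1 e1).resolve_left hcr; linarith

theorem mem_vtx_iff {P : Set Plane} {v : Plane} :
    v ∈ vtx P ↔ ∃ a b c, a ∈ nearest P v ∧ b ∈ nearest P v ∧ c ∈ nearest P v ∧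
      a ≠ b ∧ a ≠ c ∧ b ≠ c := by
  constructor
  · intro h
    obtain ⟨t, ht, hc⟩ := Set.exists_subset_encard_eq (show 3 ≤ (nearest P v).encard from h)
    obtain ⟨a, b, c, hab, hac, hbc, rfl⟩ := Set.encard_eq_three.1 hc
    exact ⟨a, b, c, ht (by simp), ht (by simp), ht (by simp), hab, hac, hbc⟩
  · rintro ⟨a, b, c, ha, hb, hc, hab, hac, hbc⟩
    have h3 : ({a, b, c} : Set Plane).encard = 3 :=
      Set.encard_eq_three.2 ⟨a, b, c, hab, hac, hbc, rfl⟩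
    change 3 ≤ (nearest P v).encard
    rw [← h3]
    refine Set.encard_le_encard ?_
    rintro x (rfl | rfl | rfl) <;> assumption

theorem finite_nearest {P : Set Plane} (hP : P.Finite) (x : Plane) : (nearest P x).Finite :=
  hP.subset fun _ h => h.1

theorem finite_vtx {P : Set Plane} (hP : P.Finite) : (vtx P).Finite := by
  have h : ∀ v, ∃ t : Plane × Plane × Plane, v ∈ vtx P →
      t.1 ∈ nearest P v ∧ t.2.1 ∈ nearest P v ∧ t.2.2 ∈ nearest P v ∧
      t.1 ≠ t.2.1 ∧ t.1 ≠ t.2.2 ∧ t.2.1 ≠ t.2.2 := by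
    intro v
    by_cases hv : v ∈ vtx P
    · obtain ⟨a, b, c, h⟩ := mem_vtx_iff.1 hv
      exact ⟨(a, b, c), fun _ => h⟩
    · exact ⟨(v, v, v), fun h => absurd h hv⟩
  choose f hf using h
  refine Set.Finite.of_finite_image (f := f)
    ((hP.prod (hP.prod hP)).subset ?_) ?_
  · rintro _ ⟨v, hv, rfl⟩
    obtain ⟨ha, hb, hc, -⟩ := hf v hv
    exact ⟨ha.1, hb.1, hc.1⟩
  · intro v hv w hw hvw
    obtain ⟨ha, hb, hc, hab, hac, hbc⟩ := hf v hv
    obtain ⟨ha', hb', hc', -⟩ := hf w hw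
    rw [← hvw] at ha' hb' hc'
    have h1 := eq_of_mem_nearest ha hb
    have h2 := eq_of_mem_nearest ha hc
    exact eq_of_equidistant (cross_ne_zero_of_equidistant hab hac hbc h1 h2) h1 h2
      (eq_of_mem_nearest ha' hb') (eq_of_mem_nearest ha' hc')

theorem ncard_nearest_of_Ic_eq_zero {P : Set Plane} (hP : P.Finite) (h : Ic P = 0) :
    ∀ v ∈ vtx P, (nearest P v).ncard = 3 := by
  have hV := finite_vtx hP
  have hnn : ∀ v ∈ vtx P, 3 ≤ (nearest P v).ncard := by
    intro v hv
    have h3 : 3 ≤ (nearest P v).encard := hv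
    rw [← (finite_nearest hP v).cast_ncard_eq] at h3
    exact_mod_cast h3
  rw [Ic, finsum_mem_eq_finite_toFinset_sum _ hV, Finset.sum_eq_zero_iff_of_nonneg] at h
  · intro v hv
    have := h v (by simpa using hv)
    omega
  · intro v hv
    have := hnn v (by simpa using hv)
    omega

theorem eq_triple_of_mem_vtx {P : Set Plane} (hP : P.Finite) {v a b c : Plane}
    (h3 : (nearest P v).ncard = 3)
    (ha : a ∈ nearest P v) (hb : b ∈ nearest P v) (hc : c ∈ nearest P v)
    (hab : a ≠ b) (hac : a ≠ c) (hbc : b ≠ c) : nearest P v = {a, b, c} := by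
  symm
  refine Set.eq_of_subset_of_ncard_le ?_ ?_ (finite_nearest hP v)
  · rintro x (rfl | rfl | rfl) <;> assumption
  · rw [h3, Set.ncard_eq_three.2 ⟨a, b, c, hab, hac, hbc, rfl⟩]

/-- A maximizer over `P` of a nonzero linear form is not interior to the convex hull. -/
theorem notMem_interior_of_forall_le {P : Set Plane} {a : Plane} {A B : ℝ} (hAB : 0 < A ^ 2 + B ^ 2)
    (h : ∀ q ∈ P, A * q 0 + B * q 1 ≤ A * a 0 + B * a 1) :
    a ∉ interior (convexHull ℝ P) := by
  intro ha
  have hlin : IsLinearMap ℝ fun x : Plane => A * x 0 + B * x 1 :=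
    ⟨fun x y => by simp; ring, fun c x => by simp; ring⟩
  have hsub : convexHull ℝ P ⊆ {x : Plane | A * x 0 + B * x 1 ≤ A * a 0 + B * a 1} :=
    convexHull_min h (convex_halfSpace_le hlin _)
  have hcont : ContinuousAt (fun ε : ℝ => a + ε • (!₂[A, B] : Plane)) 0 := by fun_prop
  have hev := hcont.eventually_mem (s := convexHull ℝ P)
    (by simpa using mem_interior_iff_mem_nhds.1 ha)
  obtain ⟨ε, hε, hpos⟩ :=
    ((hev.filter_mono nhdsWithin_le_nhds).and (self_mem_nhdsWithin (s := Set.Ioi 0))).exists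
  have := hsub hε
  simp at this hpos
  nlinarith [mul_pos hpos hAB]

theorem mem_Bd_iff {P : Set Plane} {a : Plane} (ha : a ∈ P) :
    a ∈ Bd P ↔ a ∉ interior (convexHull ℝ P) := by
  have h := subset_closure (subset_convexHull ℝ P ha)
  exact ⟨fun hB => hB.2.2, fun hi => ⟨ha, h, hi⟩⟩

theorem exists_support {V : Set Plane} (hV : ¬ Collinear ℝ V) {v : Plane} (hv : v ∈ Bd V) :
    ∃ A B : ℝ, 0 < A ^ 2 + B ^ 2 ∧ ∀ q ∈ V, A * q 0 + B * q 1 ≤ A * v 0 + B * v 1 := by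
  have hconv := convex_convexHull ℝ V
  have hne : (interior (convexHull ℝ V)).Nonempty := by
    rw [interior_convexHull_nonempty_iff_affineSpan_eq_top]
    have hVne : V.Nonempty := ⟨v, hv.1⟩
    rw [collinear_iff_finrank_le_one] at hV
    rw [← AffineSubspace.direction_eq_top_iff_of_nonempty (hVne.affineSpan ℝ),
      direction_affineSpan]
    apply Submodule.eq_top_of_finrank_eq
    have := (vectorSpan ℝ V).finrank_le
    simp at this ⊢
    omega
  obtain ⟨f, hf⟩ := geometric_hahn_banach_open_point hconv.interior isOpen_interior
    ((mem_Bd_iff hv.1).1 hv)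
  have hle : ∀ q ∈ V, f q ≤ f v := by
    intro q hq
    have hq' : q ∈ closure (interior (convexHull ℝ V)) := by
      rw [hconv.closure_interior_eq_closure_of_nonempty_interior hne]
      exact subset_closure (subset_convexHull ℝ V hq)
    exact closure_minimal (fun x hx => (hf x hx).le)
      (isClosed_le f.continuous continuous_const : IsClosed {x | f x ≤ f v}) hq'
  have hfc : ∀ x : Plane, f x = f !₂[1, 0] * x 0 + f !₂[0, 1] * x 1 := by
    intro x
    have : x = x 0 • (!₂[1, 0] : Plane) + x 1 • (!₂[0, 1] : Plane) :=
      plane_ext (by simp) (by simp)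
    conv_lhs => rw [this]
    simp only [map_add, map_smul, smul_eq_mul]
    ring
  refine ⟨f !₂[1, 0], f !₂[0, 1], ?_, fun q hq => ?_⟩
  · obtain ⟨x, hx⟩ := hne
    by_contra hcon
    have h0 : f !₂[1, 0] = 0 := by
      nlinarith [sq_nonneg (f !₂[1, 0]), sq_nonneg (f !₂[0, 1])]
    have h1 : f !₂[0, 1] = 0 := by
      nlinarith [sq_nonneg (f !₂[1, 0]), sq_nonneg (f !₂[0, 1])]
    have := hf x hx
    rw [hfc x, hfc v, h0, h1] at this
    simp at this
  · rw [← hfc, ← hfc]; exact hle q hq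

/-- If the Voronoi edge leaving `v` between `a` and `b` increases a linear form maximized over the
Voronoi vertices at `v`, then this edge is unbounded, so `a b` lies on the hull of `P`. -/
theorem cross_nonneg_of_support {P : Set Plane} (hP : P.Finite) {v a b c : Plane} {A B : ℝ}
    (h3 : (nearest P v).ncard = 3)
    (ha : a ∈ nearest P v) (hb : b ∈ nearest P v) (hc : c ∈ nearest P v)
    (hcr : 0 < cross a b c)
    (hsup : ∀ q ∈ vtx P, A * q 0 + B * q 1 ≤ A * v 0 + B * v 1)
    (hpos : 0 < A * (b 1 - a 1) - B * (b 0 - a 0)) :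
    ∀ q ∈ P, 0 ≤ cross a b q := by
  by_contra! hcon
  have hab : a ≠ b := by rintro rfl; simp [cross] at hcr
  have hac : a ≠ c := by rintro rfl; simp [cross] at hcr
  have hbc : b ≠ c := by rintro rfl; simp [cross, mul_comm] at hcr
  set s : Plane → ℝ := fun q =>
    ((v 0 - q 0) ^ 2 + (v 1 - q 1) ^ 2 - ((v 0 - a 0) ^ 2 + (v 1 - a 1) ^ 2)) /
      (-2 * cross a b q) with hs
  have hQ : {q ∈ P | cross a b q < 0}.Finite := hP.subset fun _ h => h.1
  obtain ⟨q, ⟨hq, hqneg⟩, hmin⟩ := Set.exists_min_image _ s hQ hcon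
  have hamin := (mem_nearest_iff.1 ha).2
  have hs0 : 0 ≤ s q := div_nonneg (by linarith [hamin q hq]) (by linarith)
  set w : Plane := !₂[v 0 + s q * (b 1 - a 1), v 1 - s q * (b 0 - a 0)] with hw
  have hw0 : w 0 = v 0 + s q * (b 1 - a 1) := by simp [hw]
  have hw1 : w 1 = v 1 - s q * (b 0 - a 0) := by simp [hw]
  have hdiff : ∀ x : Plane, (w 0 - x 0) ^ 2 + (w 1 - x 1) ^ 2 =
      (w 0 - a 0) ^ 2 + (w 1 - a 1) ^ 2 +
      ((v 0 - x 0) ^ 2 + (v 1 - x 1) ^ 2 - ((v 0 - a 0) ^ 2 + (v 1 - a 1) ^ 2)) -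
        s q * (-2 * cross a b x) := by
    intro x; rw [hw0, hw1]; unfold cross; ring
  have haw : a ∈ nearest P w := by
    refine mem_nearest_iff.2 ⟨ha.1, fun x hx => ?_⟩
    rw [hdiff x]
    rcases lt_or_ge (cross a b x) 0 with h | h
    · have := (le_div_iff₀ (by linarith)).1 (hmin x ⟨hx, h⟩)
      linarith
    · nlinarith [hamin x hx, mul_nonneg hs0 h]
  have transfer : ∀ x ∈ P, (w 0 - x 0) ^ 2 + (w 1 - x 1) ^ 2 =
      (w 0 - a 0) ^ 2 + (w 1 - a 1) ^ 2 → x ∈ nearest P w := fun x hx h =>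
    mem_nearest_iff.2 ⟨hx, fun y hy => h ▸ (mem_nearest_iff.1 haw).2 y hy⟩
  have hbw : b ∈ nearest P w := by
    refine transfer b hb.1 ?_
    rw [hdiff b, ← eq_of_mem_nearest ha hb]; unfold cross; ring
  have hqw : q ∈ nearest P w := by
    refine transfer q hq ?_
    have : s q * (-2 * cross a b q) = _ := div_mul_cancel₀ _ (by linarith)
    rw [hdiff q, this]; ring
  have hqa : a ≠ q := by rintro rfl; simp [cross] at hqneg
  have hqb : b ≠ q := by rintro rfl; simp [cross, mul_comm] at hqneg
  have hle := hsup w (mem_vtx_iff.2 ⟨a, b, q, haw, hbw, hqw, hab, hqa, hqb⟩)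
  rw [hw0, hw1] at hle
  have hsz : s q = 0 := by
    refine le_antisymm ?_ hs0
    by_contra! hlt
    nlinarith [mul_pos hlt hpos]
  have hwv : w = v := plane_ext (by rw [hw0, hsz]; ring) (by rw [hw1, hsz]; ring)
  rw [hwv, eq_triple_of_mem_vtx hP h3 ha hb hc hab hac hbc] at hqw
  rcases hqw with rfl | rfl | rfl
  · exact hqa rfl
  · exact hqb rfl
  · linarith

theorem exists_hull_edge {P : Set Plane} (hP : P.Finite) {v : Plane} (hv : v ∈ vtx P)
    (h3 : (nearest P v).ncard = 3) {A B : ℝ} (hAB : 0 < A ^ 2 + B ^ 2)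
    (hsup : ∀ q ∈ vtx P, A * q 0 + B * q 1 ≤ A * v 0 + B * v 1) :
    ∃ a ∈ nearest P v, ∃ b ∈ nearest P v, ∃ c ∈ nearest P v, 0 < cross a b c ∧
      ∀ q ∈ P, 0 ≤ cross a b q := by
  have main : ∀ a ∈ nearest P v, ∀ b ∈ nearest P v, ∀ c ∈ nearest P v, 0 < cross a b c →
      ∃ a ∈ nearest P v, ∃ b ∈ nearest P v, ∃ c ∈ nearest P v, 0 < cross a b c ∧
        ∀ q ∈ P, 0 ≤ cross a b q := by
    intro a ha b hb c hc hcr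
    have hcr₁ : 0 < cross b c a := by unfold cross at *; linarith
    have hcr₂ : 0 < cross c a b := by unfold cross at *; linarith
    by_cases h₁ : 0 < A * (b 1 - a 1) - B * (b 0 - a 0)
    · exact ⟨a, ha, b, hb, c, hc, hcr, cross_nonneg_of_support hP h3 ha hb hc hcr hsup h₁⟩
    by_cases h₂ : 0 < A * (c 1 - b 1) - B * (c 0 - b 0)
    · exact ⟨b, hb, c, hc, a, ha, hcr₁, cross_nonneg_of_support hP h3 hb hc ha hcr₁ hsup h₂⟩
    by_cases h₃ : 0 < A * (a 1 - c 1) - B * (a 0 - c 0)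
    · exact ⟨c, hc, a, ha, b, hb, hcr₂, cross_nonneg_of_support hP h3 hc ha hb hcr₂ hsup h₃⟩
    exfalso
    have e₁ : A * (b 1 - a 1) - B * (b 0 - a 0) = 0 := by linarith
    have e₂ : A * (c 1 - a 1) - B * (c 0 - a 0) = 0 := by linarith
    have hA : cross a b c * A = 0 := by
      unfold cross; linear_combination (b 0 - a 0) * e₂ - (c 0 - a 0) * e₁
    have hB : cross a b c * B = 0 := by
      unfold cross; linear_combination (b 1 - a 1) * e₂ - (c 1 - a 1) * e₁
    rw [(mul_eq_zero.1 hA).resolve_left hcr.ne', (mul_eq_zero.1 hB).resolve_left hcr.ne'] at hAB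
    simp at hAB
  obtain ⟨a, b, c, ha, hb, hc, hab, hac, hbc⟩ := mem_vtx_iff.1 hv
  rcases (cross_ne_zero_of_equidistant hab hac hbc (eq_of_mem_nearest ha hb)
    (eq_of_mem_nearest ha hc)).lt_or_gt with h | h
  · exact main b hb a ha c hc (by unfold cross at *; linarith)
  · exact main a ha b hb c hc h

theorem hull_edge_unique {P : Set Plane} {v v' a b c b' c' : Plane}
    (ha : a ∈ nearest P v) (hb : b ∈ nearest P v) (hc : c ∈ nearest P v)
    (hcr : 0 < cross a b c) (hhull : ∀ q ∈ P, 0 ≤ cross a b q)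
    (ha' : a ∈ nearest P v') (hb' : b' ∈ nearest P v') (hc' : c' ∈ nearest P v')
    (hcr' : 0 < cross a b' c') (hhull' : ∀ q ∈ P, 0 ≤ cross a b' q) : v = v' := by
  have hab : a ≠ b := by rintro rfl; simp [cross] at hcr
  have hab' : a ≠ b' := by rintro rfl; simp [cross] at hcr'
  have hL : 0 < (b 0 - a 0) ^ 2 + (b 1 - a 1) ^ 2 := by
    by_contra! h
    exact hab (plane_ext (by nlinarith [sq_nonneg (b 0 - a 0), sq_nonneg (b 1 - a 1)])
      (by nlinarith [sq_nonneg (b 0 - a 0), sq_nonneg (b 1 - a 1)]))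
  have h0 : cross a b b' = 0 := by
    have h₁ := hhull b' hb'.1
    have h₂ := hhull' b hb.1
    unfold cross at *; linarith
  obtain ⟨k, e0, e1⟩ := exists_mul_of_cross_eq_zero hab h0
  have hcrk : ∀ q, cross a b' q = k * cross a b q := by
    intro q; unfold cross; rw [e0, e1]; ring
  have hk : 0 < k := by
    by_contra! h
    have := hhull' c hc.1
    rw [hcrk] at this
    rcases h.lt_or_eq with h | h
    · nlinarith [mul_pos (neg_pos.2 h) hcr]
    · rw [hcrk, h] at hcr'; simp at hcr'
  have hb0 : b' 0 = a 0 + k * (b 0 - a 0) := by linarith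
  have hb1 : b' 1 = a 1 + k * (b 1 - a 1) := by linarith
  have hk1 : k = 1 := by
    have e := eq_of_mem_nearest ha hb
    have e' := eq_of_mem_nearest ha' hb'
    have l := (mem_nearest_iff.1 ha).2 b' hb'.1
    have l' := (mem_nearest_iff.1 ha').2 b hb.1
    rw [hb0, hb1] at e' l
    refine le_antisymm ?_ ?_
    · by_contra! h
      have : 0 < k * ((k - 1) * ((b 0 - a 0) ^ 2 + (b 1 - a 1) ^ 2)) :=
        mul_pos hk (mul_pos (by linarith) hL)
      nlinarith [mul_le_mul_of_nonneg_left l' hk.le]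
    · by_contra! h
      have : 0 < k * ((1 - k) * ((b 0 - a 0) ^ 2 + (b 1 - a 1) ^ 2)) :=
        mul_pos hk (mul_pos (by linarith) hL)
      nlinarith
  have hbb : b' = b := plane_ext (by rw [hb0, hk1]; ring) (by rw [hb1, hk1]; ring)
  subst hbb
  have e := eq_of_mem_nearest ha hb
  have e' := eq_of_mem_nearest ha' hb'
  have horth : (v' 0 - v 0) * (b' 0 - a 0) + (v' 1 - v 1) * (b' 1 - a 1) = 0 := by
    linear_combination (e' - e) / 2
  obtain ⟨T, hT⟩ : ∃ T, T = (v' 1 - v 1) * (b' 0 - a 0) - (v' 0 - v 0) * (b' 1 - a 1) := ⟨_, rfl⟩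
  have hTc : ∀ q : Plane, T * cross a b' q = ((b' 0 - a 0) ^ 2 + (b' 1 - a 1) ^ 2) *
      ((v' 0 - v 0) * (q 0 - a 0) + (v' 1 - v 1) * (q 1 - a 1)) := by
    intro q; rw [hT]; unfold cross
    linear_combination (-(b' 0 - a 0) * (q 0 - a 0) - (b' 1 - a 1) * (q 1 - a 1)) * horth
  have hT0 : T ≤ 0 := by
    by_contra! h
    have l := (mem_nearest_iff.1 ha').2 c hc.1
    have e := eq_of_mem_nearest ha hc
    have h1 := mul_pos h hcr
    rw [hTc] at h1
    have := pos_of_mul_pos_right h1 hL.le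
    linarith
  have hT1 : 0 ≤ T := by
    by_contra! h
    have l := (mem_nearest_iff.1 ha).2 c' hc'.1
    have e := eq_of_mem_nearest ha' hc'
    have h1 := mul_neg_of_neg_of_pos h hcr'
    rw [hTc] at h1
    have := neg_of_mul_neg_right h1 hL.le
    linarith
  have hTz : T = 0 := le_antisymm hT0 hT1
  rw [hT] at hTz
  have z : ((b' 0 - a 0) ^ 2 + (b' 1 - a 1) ^ 2) * (v' 0 - v 0) = 0 := by
    linear_combination (b' 0 - a 0) * horth - (b' 1 - a 1) * hTz
  have z' : ((b' 0 - a 0) ^ 2 + (b' 1 - a 1) ^ 2) * (v' 1 - v 1) = 0 := by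
    linear_combination (b' 1 - a 1) * horth + (b' 0 - a 0) * hTz
  have := (mul_eq_zero.1 z).resolve_left hL.ne'
  have := (mul_eq_zero.1 z').resolve_left hL.ne'
  exact plane_ext (by linarith) (by linarith)

theorem ncard_Bd_vtx_le {P : Set Plane} (hP : P.Finite)
    (h3 : ∀ v ∈ vtx P, (nearest P v).ncard = 3) (hV : ¬ Collinear ℝ (vtx P)) :
    (Bd (vtx P)).ncard ≤ (Bd P).ncard := by
  have h : ∀ v ∈ Bd (vtx P), ∃ a ∈ nearest P v, ∃ b ∈ nearest P v, ∃ c ∈ nearest P v,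
      0 < cross a b c ∧ ∀ q ∈ P, 0 ≤ cross a b q := by
    intro v hv
    obtain ⟨A, B, hAB, hsup⟩ := exists_support hV hv
    exact exists_hull_edge hP hv.1 (h3 v hv.1) hAB hsup
  choose! f ha b hb c hc hcr hhull using h
  refine Set.ncard_le_ncard_of_injOn f ?_ ?_ (hP.subset fun _ h => h.1)
  · intro v hv
    refine (mem_Bd_iff (ha v hv).1).2
      (notMem_interior_of_forall_le (A := b v 1 - f v 1) (B := -(b v 0 - f v 0)) ?_ ?_)
    · by_contra! h
      have h0 : b v 0 - f v 0 = 0 := by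
        nlinarith [sq_nonneg (b v 0 - f v 0), sq_nonneg (b v 1 - f v 1)]
      have h1 : b v 1 - f v 1 = 0 := by
        nlinarith [sq_nonneg (b v 0 - f v 0), sq_nonneg (b v 1 - f v 1)]
      have := hcr v hv
      simp [cross, h0, h1] at this
    · intro q hq
      have := hhull v hv q hq
      unfold cross at this; linarith
  · intro v hv w hw hvw
    have haw := ha w hw
    have hcrw := hcr w hw
    have hhullw := hhull w hw
    rw [← hvw] at haw hcrw hhullw
    exact hull_edge_unique (ha v hv) (hb v hv) (hc v hv) (hcr v hv) (hhull v hv)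
      haw (hb w hw) (hc w hw) hcrw hhullw

/-- In the coordinates `X`, `Y`, the point `p` lies strictly below a segment spanned by `S`. -/
def Below {ι : Type*} (S : Set ι) (X Y : ι → ℝ) (p : ι) : Prop :=
  ∃ q₁ ∈ S, ∃ q₂ ∈ S, X q₁ < X p ∧ X p < X q₂ ∧
    0 < (Y q₁ - Y p) * (X q₂ - X p) + (Y q₂ - Y p) * (X p - X q₁)

/-- A point of a finite set lying below no segment has a supporting line from above. -/
theorem exists_slope {ι : Type*} {S : Set ι} (hS : S.Finite) (X Y : ι → ℝ) (hX : Set.InjOn X S)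
    {p : ι} (hp : p ∈ S) (hB : ¬ Below S X Y p) :
    ∃ m : ℝ, ∀ q ∈ S, Y q - Y p ≤ m * (X q - X p) := by
  set s : ι → ℝ := fun q => (Y q - Y p) / (X q - X p) with hs
  set R := s '' {q ∈ S | X p < X q} with hR
  set L := s '' {q ∈ S | X q < X p} with hL
  have hRf : R.Finite := (hS.subset fun _ h => h.1).image s
  have hLf : L.Finite := (hS.subset fun _ h => h.1).image s
  have hle : ∀ x ∈ R, ∀ y ∈ L, x ≤ y := by
    rintro _ ⟨r, ⟨hr, hr'⟩, rfl⟩ _ ⟨l, ⟨hl, hl'⟩, rfl⟩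
    have h : ¬ 0 < (Y l - Y p) * (X r - X p) + (Y r - Y p) * (X p - X l) :=
      fun h => hB ⟨l, hl, r, hr, hl', hr', h⟩
    have e : s l = (Y p - Y l) / (X p - X l) := by
      rw [hs]; simp only; rw [← neg_div_neg_eq, neg_sub, neg_sub]
    rw [e, hs]
    simp only
    rw [div_le_div_iff₀ (by linarith) (by linarith)]
    linarith
  obtain ⟨m, hmR, hmL⟩ : ∃ m, m ∈ upperBounds R ∧ m ∈ lowerBounds L := by
    rcases R.eq_empty_or_nonempty with h | hRn
    · obtain ⟨m, hm⟩ := hLf.bddBelow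
      exact ⟨m, by simp [h], hm⟩
    rcases L.eq_empty_or_nonempty with h | hLn
    · obtain ⟨m, hm⟩ := hRf.bddAbove
      exact ⟨m, hm, by simp [h]⟩
    exact exists_between_of_forall_le hRn hLn hle
  refine ⟨m, fun q hq => ?_⟩
  rcases lt_trichotomy (X q) (X p) with h | h | h
  · have := hmL ⟨q, ⟨hq, h⟩, rfl⟩
    exact (le_div_iff_of_neg (by linarith)).1 this
  · simp [hX hq hp h]
  · have := hmR ⟨q, ⟨hq, h⟩, rfl⟩
    exact (div_le_iff₀ (by linarith)).1 this

theorem exists_generic_direction {P : Set Plane} (hP : P.Finite) :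
    ∃ t : ℝ, Set.InjOn (fun q : Plane => q 0 - t * q 1) P := by
  obtain ⟨t, ht⟩ := ((hP.prod hP).image
    fun z : Plane × Plane => (z.1 0 - z.2 0) / (z.1 1 - z.2 1)).exists_notMem
  refine ⟨t, fun p hp q hq h => ?_⟩
  simp only at h
  by_cases h1 : p 1 - q 1 = 0
  · have h1' : p 1 = q 1 := by linarith
    rw [h1'] at h
    exact plane_ext (by linarith) h1'
  · exact absurd ⟨(p, q), ⟨hp, hq⟩, by field_simp; linarith⟩ ht

theorem mem_Bd_of_not_below {P : Set Plane} (hP : P.Finite) {t σ : ℝ} (hσ : σ ^ 2 = 1)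
    (hX : Set.InjOn (fun q : Plane => q 0 - t * q 1) P) {p : Plane} (hp : p ∈ P)
    (hB : ¬ Below P (fun q => q 0 - t * q 1) (fun q => σ * (t * q 0 + q 1)) p) : p ∈ Bd P := by
  obtain ⟨m, hm⟩ := exists_slope hP _ _ hX hp hB
  refine (mem_Bd_iff hp).2
    (notMem_interior_of_forall_le (A := σ * t - m) (B := σ + m * t) ?_ ?_)
  · have : (σ * t - m) ^ 2 + (σ + m * t) ^ 2 = (σ ^ 2 + m ^ 2) * (1 + t ^ 2) := by ring
    rw [this, hσ]; positivity
  · intro q hq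
    have := hm q hq
    simp only at this
    linarith

theorem exists_top_vertex {P : Set Plane} (hP : P.Finite) {t σ : ℝ} (hσ : σ ^ 2 = 1)
    (hX : Set.InjOn (fun q : Plane => q 0 - t * q 1) P) {p : Plane} (hp : p ∈ P)
    (hB : Below P (fun q => q 0 - t * q 1) (fun q => σ * (t * q 0 + q 1)) p) :
    ∃ v ∈ vtx P, σ * (t * p 0 + p 1) < σ * (t * v 0 + v 1) ∧ p ∈ nearest P v ∧
      (∃ q ∈ nearest P v, q 0 - t * q 1 < p 0 - t * p 1) ∧
      ∃ q ∈ nearest P v, p 0 - t * p 1 < q 0 - t * q 1 := by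
  obtain ⟨q₁, h₁, q₂, h₂, hl, hr, hup⟩ := hB
  obtain ⟨ξ, η, hlt, hcell, ⟨a, ha, hap, hae⟩, b, hb, hbp, hbe⟩ :=
    exists_top hP _ (fun q : Plane => σ * (t * q 0 + q 1)) hX hp h₁ h₂ hl hr hup
  have ht : 0 < 1 + t ^ 2 := by positivity
  obtain ⟨v, hξ, hη⟩ : ∃ v : Plane, ξ = v 0 - t * v 1 ∧ η = σ * (t * v 0 + v 1) := by
    refine ⟨!₂[(ξ + t * (σ * η)) / (1 + t ^ 2), (σ * η - t * ξ) / (1 + t ^ 2)], ?_, ?_⟩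
    · simp; field_simp; ring
    · simp; field_simp; linear_combination (-η * (1 + t ^ 2)) * hσ
  subst hξ hη
  have hnorm : ∀ q : Plane, (v 0 - t * v 1 - (q 0 - t * q 1)) ^ 2 +
      (σ * (t * v 0 + v 1) - σ * (t * q 0 + q 1)) ^ 2 =
      (1 + t ^ 2) * ((v 0 - q 0) ^ 2 + (v 1 - q 1) ^ 2) := by
    intro q
    linear_combination (t * v 0 + v 1 - (t * q 0 + q 1)) ^ 2 * hσ
  simp only [hnorm] at hcell hae hbe
  have hpv : p ∈ nearest P v :=
    mem_nearest_iff.2 ⟨hp, fun q hq => le_of_mul_le_mul_left (hcell q hq) ht⟩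
  have tr : ∀ q ∈ P, (1 + t ^ 2) * ((v 0 - q 0) ^ 2 + (v 1 - q 1) ^ 2) =
      (1 + t ^ 2) * ((v 0 - p 0) ^ 2 + (v 1 - p 1) ^ 2) → q ∈ nearest P v := fun q hq h =>
    mem_nearest_iff.2 ⟨hq, fun y hy =>
      (mul_left_cancel₀ ht.ne' h) ▸ (mem_nearest_iff.1 hpv).2 y hy⟩
  have hav := tr a ha hae
  have hbv := tr b hb hbe
  refine ⟨v, mem_vtx_iff.2 ⟨a, p, b, hav, hpv, hbv, ?_, ?_, ?_⟩, hlt, hpv, ⟨a, hav, hap⟩,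
    b, hbv, hbp⟩
  · rintro rfl; exact lt_irrefl _ hap
  · rintro rfl; exact lt_irrefl _ (hap.trans hbp)
  · rintro rfl; exact lt_irrefl _ hbp

theorem below_or_below {P : Set Plane} (hcol : ¬ Collinear ℝ P) {t : ℝ}
    (hX : Set.InjOn (fun q : Plane => q 0 - t * q 1) P) {p l r : Plane}
    (hp : p ∈ P) (hl : l ∈ P) (hr : r ∈ P)
    (hlp : l 0 - t * l 1 < p 0 - t * p 1) (hpr : p 0 - t * p 1 < r 0 - t * r 1) :
    Below P (fun q => q 0 - t * q 1) (fun q => 1 * (t * q 0 + q 1)) p ∨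
      Below P (fun q => q 0 - t * q 1) (fun q => -1 * (t * q 0 + q 1)) p := by
  by_contra! hcon
  obtain ⟨hU, hD⟩ := hcon
  have hne : p ≠ r := by rintro rfl; exact lt_irrefl _ hpr
  have ht : (0 : ℝ) < 1 + t ^ 2 := by positivity
  have key : ∀ x ∈ P, ∀ y ∈ P, x 0 - t * x 1 < p 0 - t * p 1 → p 0 - t * p 1 < y 0 - t * y 1 →
      cross p y x = 0 := by
    intro x hx y hy hxp hpy
    have h₁ : ¬ _ := fun h => hU ⟨x, hx, y, hy, hxp, hpy, h⟩
    have h₂ : ¬ _ := fun h => hD ⟨x, hx, y, hy, hxp, hpy, h⟩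
    have : (1 + t ^ 2) * cross p y x = 0 := by
      unfold cross; linarith
    exact (mul_eq_zero.1 this).resolve_left ht.ne'
  refine hcol (collinear_of_cross_eq_zero hne fun q hq => ?_)
  rcases lt_trichotomy (q 0 - t * q 1) (p 0 - t * p 1) with h | h | h
  · exact key q hq r hr h hpr
  · rw [hX hq hp h]; simp [cross]
  · have h₁ := key l hl r hr hlp hpr
    have h₂ := key l hl q hq hlp h
    have : (p 0 - t * p 1 - (l 0 - t * l 1)) * cross p r q = 0 := by
      unfold cross at *
      linear_combination (r 0 - p 0 - t * (r 1 - p 1)) * h₂ - (q 0 - p 0 - t * (q 1 - p 1)) * h₁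
    exact (mul_eq_zero.1 this).resolve_left (by linarith)

theorem two_mul_ncard_le {P : Set Plane} (hP : P.Finite) (hcol : ¬ Collinear ℝ P)
    (h3 : ∀ v ∈ vtx P, (nearest P v).ncard = 3) :
    2 * P.ncard ≤ (vtx P).ncard + ((Bd P).ncard + 2) := by
  obtain ⟨t, hX⟩ := exists_generic_direction hP
  set U := {p ∈ P | Below P (fun q => q 0 - t * q 1) (fun q => 1 * (t * q 0 + q 1)) p} with hU
  set D := {p ∈ P | Below P (fun q => q 0 - t * q 1) (fun q => -1 * (t * q 0 + q 1)) p} with hD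
  have hUf : U.Finite := hP.subset fun _ h => h.1
  have hDf : D.Finite := hP.subset fun _ h => h.1
  have hVf := finite_vtx hP
  have fU : ∀ p ∈ U, _ := fun p hp =>
    exists_top_vertex hP (σ := 1) (by norm_num) hX hp.1 hp.2
  have fD : ∀ p ∈ D, _ := fun p hp =>
    exists_top_vertex hP (σ := -1) (by norm_num) hX hp.1 hp.2
  choose! f f1 f2 f3 f4 f5 using fU
  choose! g g1 g2 g3 g4 g5 using fD
  have middle : ∀ v ∈ vtx P, ∀ p ∈ nearest P v, ∀ p' ∈ nearest P v,
      (∃ q ∈ nearest P v, q 0 - t * q 1 < p 0 - t * p 1) →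
      (∃ q ∈ nearest P v, p 0 - t * p 1 < q 0 - t * q 1) →
      (∃ q ∈ nearest P v, q 0 - t * q 1 < p' 0 - t * p' 1) →
      (∃ q ∈ nearest P v, p' 0 - t * p' 1 < q 0 - t * q 1) → p = p' := by
    rintro v hv p hp p' hp' ⟨a, ha, hap⟩ ⟨b, hb, hpb⟩ ⟨a', ha', hap'⟩ ⟨b', hb', hpb'⟩
    have htr := eq_triple_of_mem_vtx hP (h3 v hv) ha hp hb
      (by rintro rfl; exact lt_irrefl _ hap)
      (by rintro rfl; exact lt_irrefl _ (hap.trans hpb))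
      (by rintro rfl; exact lt_irrefl _ hpb)
    rw [htr] at hp' ha' hb'
    rcases hp' with rfl | rfl | rfl
    · rcases ha' with rfl | rfl | rfl <;> linarith
    · rfl
    · rcases hb' with rfl | rfl | rfl <;> linarith
  have finj : Set.InjOn f U := fun p hp p' hp' h =>
    middle (f p) (f1 p hp) p (f3 p hp) p' (h ▸ f3 p' hp') (f4 p hp) (f5 p hp)
      (h ▸ f4 p' hp') (h ▸ f5 p' hp')
  have ginj : Set.InjOn g D := fun p hp p' hp' h =>
    middle (g p) (g1 p hp) p (g3 p hp) p' (h ▸ g3 p' hp') (g4 p hp) (g5 p hp)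
      (h ▸ g4 p' hp') (h ▸ g5 p' hp')
  have hdisj : Disjoint (f '' U) (g '' D) := by
    rw [Set.disjoint_left]
    rintro _ ⟨p, hp, rfl⟩ ⟨p', hp', h⟩
    have : p = p' := middle (f p) (f1 p hp) p (f3 p hp) p' (h ▸ g3 p' hp') (f4 p hp) (f5 p hp)
      (h ▸ g4 p' hp') (h ▸ g5 p' hp')
    subst this
    have h₁ := f2 p hp
    have h₂ := g2 p hp'
    rw [h] at h₂
    linarith
  have hle : U.ncard + D.ncard ≤ (vtx P).ncard := by
    rw [← finj.ncard_image, ← ginj.ncard_image,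
      ← Set.ncard_union_eq hdisj (hUf.image f) (hDf.image g)]
    refine Set.ncard_le_ncard ?_ hVf
    rintro _ (⟨p, hp, rfl⟩ | ⟨p, hp, rfl⟩)
    · exact f1 p hp
    · exact g1 p hp
  have hPne : P.Nonempty := by
    rw [Set.nonempty_iff_ne_empty]
    rintro rfl
    exact hcol (collinear_empty ℝ Plane)
  obtain ⟨l, hl, hlmin⟩ := Set.exists_min_image P (fun q : Plane => q 0 - t * q 1) hP hPne
  obtain ⟨r, hr, hrmax⟩ := Set.exists_max_image P (fun q : Plane => q 0 - t * q 1) hP hPne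
  have hunion : P \ {l, r} ⊆ U ∪ D := by
    rintro p ⟨hp, hpn⟩
    simp only [Set.mem_insert_iff, Set.mem_singleton_iff, not_or] at hpn
    have h₁ := lt_of_le_of_ne (hlmin p hp) fun h => hpn.1 (hX hp hl h.symm)
    have h₂ := lt_of_le_of_ne (hrmax p hp) fun h => hpn.2 (hX hp hr h)
    exact (below_or_below hcol hX hp hl hr h₁ h₂).imp (fun h => ⟨hp, h⟩) fun h => ⟨hp, h⟩
  have hinter : P \ Bd P ⊆ U ∩ D := by
    rintro p ⟨hp, hpn⟩
    refine ⟨⟨hp, ?_⟩, ⟨hp, ?_⟩⟩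
    · by_contra h
      exact hpn (mem_Bd_of_not_below hP (by norm_num) hX hp h)
    · by_contra h
      exact hpn (mem_Bd_of_not_below hP (by norm_num) hX hp h)
  have c₁ := Set.ncard_le_ncard hunion (hUf.union hDf)
  have c₂ := Set.ncard_le_ncard hinter (hUf.subset Set.inter_subset_left)
  have c₃ := Set.ncard_union_add_ncard_inter U D hUf hDf
  have c₄ : P.ncard ≤ (P \ {l, r}).ncard + 2 :=
    (Set.ncard_le_ncard_sdiff_add_ncard P {l, r}).trans
      (Nat.add_le_add_left ((Set.ncard_insert_le l {r}).trans (by simp)) _)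
  have c₅ := Set.ncard_sdiff_add_ncard_of_subset (s := Bd P) (t := P) (fun _ h => h.1) hP
  omega

theorem finite_iterate_vtx {P : Set Plane} (hP : P.Finite) (n : ℕ) : (vtx^[n] P).Finite := by
  induction n with
  | zero => exact hP
  | succ n ih => rw [Function.iterate_succ_apply']; exact finite_vtx ih

theorem ncard_Bd_iterate_vtx_le {P : Set Plane} (hP : P.Finite) (n : ℕ)
    (h : ∀ k ≤ n, ¬ Collinear ℝ (vtx^[k] P) ∧ Ic (vtx^[k] P) = 0) :
    (Bd (vtx^[n] P)).ncard ≤ (Bd P).ncard := by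
  induction n with
  | zero => exact le_rfl
  | succ n ih =>
    refine le_trans ?_ (ih fun k hk => h k (by omega))
    have h' := (h (n + 1) le_rfl).1
    rw [Function.iterate_succ_apply'] at h' ⊢
    have hf := finite_iterate_vtx hP n
    exact ncard_Bd_vtx_le hf (ncard_nearest_of_Ic_eq_zero hf (h n (by omega)).2) h'

theorem lower_bound_iterates (P : Set Plane) (hP : P.Finite) (N : ℕ)
    (h : ∀ n : ℕ, n < N → ¬ Collinear ℝ (vtx^[n] P) ∧ Ic (vtx^[n] P) = 0) :
    ((vtx^[N] P).ncard : ℤ) ≥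
      2 ^ N * (P.ncard : ℤ) - (2 ^ N - 1) * (((Bd P).ncard : ℤ) + 2) := by
  induction N with
  | zero => simp
  | succ N ih =>
    have ih' := ih fun n hn => h n (by omega)
    have hf := finite_iterate_vtx hP N
    obtain ⟨hcol, hI⟩ := h N (by omega)
    have h₁ := two_mul_ncard_le hf hcol (ncard_nearest_of_Ic_eq_zero hf hI)
    have h₂ := ncard_Bd_iterate_vtx_le hP N fun k hk => h k (by omega)
    rw [Function.iterate_succ_apply', pow_succ]
    zify at h₁ h₂
    linarith
end
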